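/- Let C be an r-colorable simplicial complex and let m = c_k(C) = T(n_k, k, r) + T(n_{k-1}, k-1, r-1) + ... + T(n_{k-s}, k-s, r-s) be the (k, r)-canonical representation of m. Then c_{k+1}(C) ≤ T(n_k, k+1, r) + T(n_{k-1}, k, r-1) + ... + T(n_{k-s}, k-s+1, r-s). -/

import Mathlib

/-- `turanCount n k r` is the number of `k`-cliques of the Turán graph `T_{n,r}`. -/
def turanCount (n k r : ℕ) : ℕ :=
  ((SimpleGraph.turanGraph n r).cliqueFinset k).card

namespace FFK
open Finset
open scoped FinsetFamily

/-- binary weight: realises the colex order -/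
def wt (S : Finset ℕ) : ℕ := ∑ i ∈ S, 2 ^ i

lemma wt_lt_iff {S T : Finset ℕ} :
    wt S < wt T ↔ ∃ a ∈ T, a ∉ S ∧ ∀ b, a < b → (b ∈ S ↔ b ∈ T) := by
  unfold wt
  rw [Finset.geomSum_lt_geomSum_iff_toColex_lt_toColex le_rfl, Finset.Colex.lt_iff_exists_filter_lt]
  constructor
  · rintro ⟨a, ha, h⟩
    simp only [mem_sdiff] at ha
    refine ⟨a, ha.1, ha.2, fun b hb => ?_⟩
    have := congrArg (fun s => b ∈ s) h
    simpa [hb] using this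
  · rintro ⟨a, ha, h1, h2⟩
    refine ⟨a, by simp [ha, h1], ?_⟩
    ext b
    simp only [mem_filter]
    constructor
    · rintro ⟨h3, h4⟩; exact ⟨(h2 b h4).1 h3, h4⟩
    · rintro ⟨h3, h4⟩; exact ⟨(h2 b h4).2 h3, h4⟩

lemma wt_inj {S T : Finset ℕ} (h : wt S = wt T) : S = T :=
  Finset.geomSum_injective (n := 2) le_rfl h

lemma wt_image_lt {e : ℕ → ℕ} (he : StrictMono e) {S T : Finset ℕ} :
    wt (S.image e) < wt (T.image e) ↔ wt S < wt T := by
  unfold wt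
  rw [Finset.geomSum_lt_geomSum_iff_toColex_lt_toColex le_rfl,
    Finset.geomSum_lt_geomSum_iff_toColex_lt_toColex le_rfl,
    Finset.Colex.toColex_image_lt_toColex_image he]

lemma wt_insert {v : ℕ} {S : Finset ℕ} (h : v ∉ S) : wt (insert v S) = 2 ^ v + wt S := by
  unfold wt; rw [sum_insert h]

/-- rainbow `k`-sets for the colouring mod `r` -/
def RB (r k : ℕ) (S : Finset ℕ) : Prop :=
  S.card = k ∧ ∀ x ∈ S, ∀ y ∈ S, x % r = y % r → x = y

def IsInit (r k : ℕ) (I : Finset (Finset ℕ)) : Prop :=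
  (∀ S ∈ I, RB r k S) ∧ ∀ S T, T ∈ I → RB r k S → wt S < wt T → S ∈ I

lemma RB.mono {r k : ℕ} {S T : Finset ℕ} (h : RB r k S) (hT : T ⊆ S) : RB r T.card T :=
  ⟨rfl, fun x hx y hy => h.2 x (hT hx) y (hT hy)⟩

lemma RB.le {r k : ℕ} {S : Finset ℕ} (hr : 0 < r) (h : RB r k S) : k ≤ r := by
  rw [← h.1, ← Finset.card_range r]
  refine Finset.card_le_card_of_injOn (· % r) (fun x _ => ?_) (fun x hx y hy => h.2 x hx y hy)
  simp [Nat.mod_lt _ hr]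

lemma RB.insert {r k : ℕ} {S : Finset ℕ} (h : RB r k S) {x : ℕ}
    (hx : ∀ y ∈ S, y % r ≠ x % r) : RB r (k + 1) (insert x S) := by
  have hxS : x ∉ S := fun h' => hx x h' rfl
  refine ⟨by rw [card_insert_of_notMem hxS, h.1], ?_⟩
  intro a ha b hb hab
  rw [mem_insert] at ha hb
  rcases ha with rfl | ha <;> rcases hb with rfl | hb
  · rfl
  · exact absurd hab.symm (hx b hb)
  · exact absurd hab (hx a ha)
  · exact h.2 a ha b hb hab

/-- there is a compatible small vertex -/
lemma exists_compat {r k n : ℕ} {S : Finset ℕ} (h : S.card = k) (hr : k < r) (hn : k < n) :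
    ∃ x < n, x < r ∧ ∀ y ∈ S, y % r ≠ x % r := by
  by_contra! hcon
  have : (range (min n r)) ⊆ S.image (· % r) := by
    intro x hx
    simp only [mem_range, lt_min_iff] at hx
    obtain ⟨y, hy, hy2⟩ := hcon x hx.1 hx.2
    rw [Nat.mod_eq_of_lt hx.2] at hy2
    exact mem_image.2 ⟨y, hy, hy2⟩
  have h1 := card_le_card this
  have h2 := card_image_le (s := S) (f := (· % r))
  rw [card_range] at h1
  omega

/-- rainbow sets in `range n` extend to size `k` -/
lemma exists_ext {r k n l : ℕ} (hr : k ≤ r) (hn : k ≤ n) {S : Finset ℕ} (h : RB r l S) (hl : l ≤ k)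
    (hS : ∀ x ∈ S, x < n) : ∃ D, S ⊆ D ∧ RB r k D ∧ ∀ x ∈ D, x < n := by
  obtain ⟨d, rfl⟩ := Nat.exists_eq_add_of_le hl
  induction d generalizing l S with
  | zero => exact ⟨S, Subset.rfl, h, hS⟩
  | succ d ih =>
    obtain ⟨x, hx, -, hc⟩ := exists_compat (r := r) (n := n) h.1 (by omega) (by omega)
    obtain ⟨D, h1, h2, h3⟩ := ih (l := l + 1) (S := insert x S) (h.insert hc)
      (by intro y hy; rw [mem_insert] at hy; rcases hy with rfl | hy; exacts [hx, hS y hy])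
      (by omega) (by omega) (by omega)
    refine ⟨D, (subset_insert _ _).trans h1, ?_, h3⟩
    rw [show l + (d + 1) = l + 1 + d by omega]; exact h2

lemma ext_lemma {r k : ℕ} {S W P : Finset ℕ} (hk : k < r) (hS : RB r k S)
    (hW : ∀ x ∈ W, ∀ y ∈ W, x % r = y % r → x = y) (hSW : wt S < wt W) (hP : RB r (k+1) P)
    (hWP : wt W ≤ wt P) : ∃ x, (∀ y ∈ S, y % r ≠ x % r) ∧ wt (insert x S) ≤ wt P := by
  obtain ⟨w, hwW, hwS, hag⟩ := wt_lt_iff.1 hSW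
  by_cases hx : ∃ x < w, ∀ y ∈ S, y % r ≠ x % r
  · obtain ⟨x, hxw, hx⟩ := hx
    refine ⟨x, hx, le_trans (le_of_lt (wt_lt_iff.2 ⟨w, hwW, ?_, ?_⟩)) hWP⟩
    · rw [mem_insert]; rintro (h | h); omega; exact hwS h
    · intro b hb; rw [mem_insert, ← hag b hb]; constructor
      · rintro (h | h); omega; exact h
      · exact Or.inr
  · push Not at hx
    have hwr : w < r := by
      obtain ⟨x, hx1, hx2, hx3⟩ := exists_compat (r := r) (n := r) hS.1 hk hk
      by_contra hcon
      obtain ⟨y, hy, hy2⟩ := hx x (by omega)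
      exact hx3 y hy hy2
    have hcomp : ∀ y ∈ S, y % r ≠ w % r := by
      intro y hy hyw
      rcases lt_trichotomy y w with h | h | h
      · rw [Nat.mod_eq_of_lt hwr, Nat.mod_eq_of_lt (by omega)] at hyw; omega
      · subst h; exact hwS hy
      · have := hW y ((hag y h).1 hy) w hwW hyw; omega
    refine ⟨w, hcomp, ?_⟩
    by_contra! hlt
    have key : ∀ b, w ≤ b → (b ∈ P ↔ b ∈ W) := by
      have h1 : ∀ b, w ≤ b → (b ∈ insert w S ↔ b ∈ W) := by
        intro b hb
        rcases hb.eq_or_lt with rfl | hb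
        · simp [hwW]
        · rw [mem_insert, ← hag b hb]; constructor
          · rintro (h | h); omega; exact h
          · exact Or.inr
      obtain ⟨p', hp'1, hp'2, hp'3⟩ := wt_lt_iff.1 hlt
      rcases hWP.eq_or_lt with h | h
      · intro b _; rw [wt_inj h]
      · obtain ⟨p, hp1, hp2, hp3⟩ := wt_lt_iff.1 h
        intro b hb
        by_cases hpw : p < w
        · exact (hp3 b (by omega)).symm
        · exfalso
          rcases lt_trichotomy p p' with h | h | h
          · exact hp'2 ((hp3 p' h).1 ((h1 p' (by omega)).1 hp'1))
          · subst h; exact hp'2 hp1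
          · exact hp2 ((h1 p (by omega)).1 ((hp'3 p h).1 hp1))
    have hsub : P ⊆ insert w S := by
      intro y hy
      rw [mem_insert]
      rcases lt_trichotomy y w with h | h | h
      · right
        obtain ⟨z, hz, hz2⟩ := hx y h
        rcases lt_trichotomy z w with h' | h' | h'
        · rw [Nat.mod_eq_of_lt (by omega : z < r), Nat.mod_eq_of_lt (by omega)] at hz2
          rwa [← hz2]
        · subst h'; exact absurd hz hwS
        · have := hP.2 z ((key z h'.le).2 ((hag z h').1 hz)) y hy hz2; omega
      · exact Or.inl h
      · right; exact (hag y h).2 ((key y h.le).1 hy)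
    have := eq_of_subset_of_card_le hsub (by rw [hP.1, (hS.insert hcomp).1])
    rw [this] at hlt; omega

/-- shadow of initial segment is initial -/
lemma IsInit.shadow {r k : ℕ} {I : Finset (Finset ℕ)} (hr : 0 < r) (h : IsInit r (k+1) I) :
    IsInit r k (∂ I) := by
  refine ⟨?_, ?_⟩
  · intro S hS
    rw [mem_shadow_iff] at hS
    obtain ⟨T, hT, a, ha, rfl⟩ := hS
    have := (h.1 T hT).mono (erase_subset a T)
    rwa [card_erase_of_mem ha, (h.1 T hT).1] at this
  · intro S T hT hS hlt
    rw [mem_shadow_iff_insert_mem] at hT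
    obtain ⟨a, ha, haT⟩ := hT
    have hP := h.1 _ haT
    have hk : k < r := hP.le hr
    obtain ⟨x, hx1, hx2⟩ := ext_lemma (W := T) hk hS
      (fun x hx y hy => hP.2 x (mem_insert_of_mem hx) y (mem_insert_of_mem hy)) hlt hP
      (by rw [wt_insert ha]; exact Nat.le_add_left _ _)
    rw [mem_shadow_iff_insert_mem]
    refine ⟨x, fun h' => hx1 x h' rfl, ?_⟩
    rcases hx2.eq_or_lt with h' | h'
    · rw [wt_inj h']; exact haT
    · exact h.2 _ _ haT (hS.insert hx1) h'

lemma IsInit.subset {r k : ℕ} {I J : Finset (Finset ℕ)} (hI : IsInit r k I) (hJ : IsInit r k J)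
    (h : I.card ≤ J.card) : I ⊆ J := by
  by_contra hcon
  obtain ⟨S, hS, hSJ⟩ := not_subset.1 hcon
  have : J ⊆ I := by
    intro T hT
    rcases lt_trichotomy (wt S) (wt T) with h' | h' | h'
    · exact absurd (hJ.2 S T hT (hI.1 S hS) h') hSJ
    · rw [wt_inj h'] at hS; exact hS
    · exact hI.2 T S hS (hJ.1 T hT) h'
  have := eq_of_subset_of_card_le this h
  rw [this] at hSJ; exact hSJ hS

instance (r k : ℕ) (S : Finset ℕ) : Decidable (RB r k S) := by unfold RB; infer_instance

/-- all rainbow `k`-sets in `range n` -/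
def allRB (r k n : ℕ) : Finset (Finset ℕ) := (range n).powerset.filter (RB r k)

lemma mem_allRB {r k n : ℕ} {S : Finset ℕ} : S ∈ allRB r k n ↔ RB r k S ∧ ∀ x ∈ S, x < n := by
  simp only [allRB, mem_filter, mem_powerset, subset_iff, mem_range]; tauto

lemma allRB_init (r k n : ℕ) : IsInit r k (allRB r k n) := by
  refine ⟨fun S hS => (mem_allRB.1 hS).1, fun S T hT hS hlt => mem_allRB.2 ⟨hS, ?_⟩⟩
  obtain ⟨a, ha, -, h⟩ := wt_lt_iff.1 hlt
  have hT := (mem_allRB.1 hT).2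
  intro x hx
  by_contra hxn
  exact hxn (hT x ((h x (by have := hT a ha; omega)).1 hx))

lemma exists_init {r k : ℕ} (F : Finset (Finset ℕ)) (hF : ∀ S ∈ F, RB r k S) :
    ∃ I, IsInit r k I ∧ I.card = F.card := by
  have hU : F ⊆ allRB r k (F.sup (fun S => S.sup id) + 1) := by
    intro S hS
    refine mem_allRB.2 ⟨hF S hS, fun x hx => Nat.lt_succ_of_le ?_⟩
    exact le_trans (le_sup (f := id) hx) (le_sup (f := fun S : Finset ℕ => S.sup id) hS)
  have : ∀ d, ∀ U, IsInit r k U → U.card = F.card + d → ∃ I, IsInit r k I ∧ I.card = F.card := by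
    intro d
    induction d with
    | zero => intro U h1 h2; exact ⟨U, h1, h2⟩
    | succ d ih =>
      intro U h1 h2
      obtain ⟨M, hM, hmax⟩ := exists_max_image U wt (card_pos.1 (by omega))
      refine ih (U.erase M) ⟨fun S hS => h1.1 S (mem_of_mem_erase hS), ?_⟩ ?_
      · intro S T hT hS hlt
        rw [mem_erase] at hT ⊢
        refine ⟨?_, h1.2 S T hT.2 hS hlt⟩
        rintro rfl
        have := hmax T hT.2; omega
      · rw [card_erase_of_mem hM]; omega
  obtain ⟨d, hd⟩ := Nat.exists_eq_add_of_le (card_le_card hU)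
  exact this d _ (allRB_init _ _ _) hd

lemma sum_init_le {r k : ℕ} {I L : Finset (Finset ℕ)} (hI : IsInit r k I) (hL : ∀ S ∈ L, RB r k S)
    (hc : I.card = L.card) (g : Finset ℕ → ℕ) (hg : ∀ S T, wt S < wt T → g S < g T) :
    ∑ S ∈ I, g S ≤ ∑ S ∈ L, g S ∧ (∑ S ∈ L, g S ≤ ∑ S ∈ I, g S → L = I) := by
  have h1 := sum_inter_add_sum_sdiff I L g
  have h2 := sum_inter_add_sum_sdiff L I g
  rw [inter_comm] at h2
  have hcc : (I \ L).card = (L \ I).card := card_sdiff_comm hc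
  rcases (I \ L).eq_empty_or_nonempty with he | hne
  · have hsub : I ⊆ L := sdiff_eq_empty_iff_subset.1 he
    have := eq_of_subset_of_card_le hsub hc.ge
    subst this
    exact ⟨le_rfl, fun _ => rfl⟩
  · obtain ⟨M, hM, hmax⟩ := exists_max_image (I \ L) g hne
    have h3 : ∑ S ∈ I \ L, g S ≤ (I \ L).card • g M := sum_le_card_nsmul (I \ L) g (g M) hmax
    have h4 : (L \ I).card • (g M + 1) ≤ ∑ S ∈ L \ I, g S := card_nsmul_le_sum (L \ I) g (g M + 1) (by
      intro T hT
      rw [mem_sdiff] at hT hM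
      refine hg M T ?_
      rcases lt_trichotomy (wt M) (wt T) with h' | h' | h'
      · exact h'
      · exact absurd (wt_inj h' ▸ hM.1) hT.2
      · exact absurd (hI.2 T M hM.1 (hL T hT.1) h') hT.2)
    rw [← hcc] at h4
    have := card_pos.2 hne
    simp only [smul_eq_mul] at h3 h4
    have h5 : (I \ L).card * (g M + 1) = (I \ L).card * g M + (I \ L).card := by ring
    constructor
    · omega
    · intro h; omega
end FFK

namespace FFK
open Finset
open scoped FinsetFamily

/-- `E` enumerates the naturals whose residue mod `n+1` is not `c`. -/
structure Emb (n c : ℕ) (E : ℕ → ℕ) : Prop where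
  mono : StrictMono E
  ne : ∀ x, E x % (n + 1) ≠ c
  surj : ∀ y, y % (n + 1) ≠ c → ∃ x, E x = y
  mod : ∀ x y, E x % (n + 1) = E y % (n + 1) ↔ x % n = y % n

def emb (n c x : ℕ) : ℕ := (n + 1) * (x / n) + (if x % n < c then x % n else x % n + 1)

lemma emb_mod {n c : ℕ} (hn : 0 < n) (x : ℕ) :
    emb n c x % (n + 1) = if x % n < c then x % n else x % n + 1 := by
  have := Nat.mod_lt x hn
  unfold emb
  rw [Nat.mul_add_mod, Nat.mod_eq_of_lt]
  split_ifs <;> omega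

lemma emb_lt_iff {n v : ℕ} (hn : 0 < n) (x : ℕ) :
    emb n (v % (n + 1)) x < v ↔ x < v - v / (n + 1) := by
  have h1 := Nat.mod_lt x hn
  have h2 := Nat.div_add_mod x n
  have h3 := Nat.mod_lt v (Nat.succ_pos n)
  have h4 := Nat.div_add_mod v (n + 1)
  unfold emb
  simp only [Nat.succ_eq_add_one] at *
  generalize v % (n + 1) = c at *
  generalize v / (n + 1) = q at *
  generalize x / n = a at *
  generalize x % n = b at *
  subst h2 h4
  have e1 : (n + 1) * q + c - q = n * q + c := by
    have : (n + 1) * q = n * q + q := by ring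
    omega
  rw [e1]
  rcases lt_trichotomy a q with h | h | h
  · obtain ⟨d, rfl⟩ := Nat.exists_eq_add_of_lt h
    have e2 : (n + 1) * (a + d + 1) = (n + 1) * a + (n * d + d) + n + 1 := by ring
    have e3 : n * (a + d + 1) = n * a + n * d + n := by ring
    rw [e2, e3]
    split_ifs <;> omega
  · subst h; split_ifs <;> omega
  · obtain ⟨d, rfl⟩ := Nat.exists_eq_add_of_lt h
    have e2 : (n + 1) * (q + d + 1) = (n + 1) * q + (n * d + d) + n + 1 := by ring
    have e3 : n * (q + d + 1) = n * q + n * d + n := by ring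
    rw [e2, e3]
    split_ifs <;> omega

lemma emb_emb {n c : ℕ} (hn : 0 < n) (hc : c ≤ n) : Emb n c (emb n c) where
  mono := by
    refine strictMono_nat_of_lt_succ fun x => ?_
    have h1 := Nat.mod_lt x hn
    have h2 := Nat.div_add_mod x n
    unfold emb
    by_cases h : x % n + 1 < n
    · have e1 : (x + 1) / n = x / n := by
        conv_lhs => rw [← h2, add_assoc, Nat.mul_add_div hn, Nat.div_eq_of_lt h, add_zero]
      have e2 : (x + 1) % n = x % n + 1 := by
        conv_lhs => rw [← h2, add_assoc, Nat.mul_add_mod, Nat.mod_eq_of_lt h]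
      rw [e1, e2]; split_ifs <;> omega
    · have h' : x % n + 1 = n := by omega
      have e1 : (x + 1) / n = x / n + 1 := by
        conv_lhs => rw [← h2, add_assoc, Nat.mul_add_div hn, h', Nat.div_self hn]
      have e2 : (x + 1) % n = 0 := by
        conv_lhs => rw [← h2, add_assoc, Nat.mul_add_mod, h', Nat.mod_self]
      rw [e1, e2, Nat.mul_add]; split_ifs <;> omega
  ne := by
    intro x; rw [emb_mod hn]; split_ifs <;> omega
  surj := by
    intro y hy
    have h1 := Nat.mod_lt y (Nat.succ_pos n)
    have h2 := Nat.div_add_mod y (n + 1)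
    simp only [Nat.succ_eq_add_one] at *
    have hb : (if y % (n+1) < c then y % (n+1) else y % (n+1) - 1) < n := by split_ifs <;> omega
    refine ⟨n * (y / (n+1)) + (if y % (n+1) < c then y % (n+1) else y % (n+1) - 1), ?_⟩
    unfold emb
    rw [Nat.mul_add_div hn, Nat.mul_add_mod, Nat.mod_eq_of_lt hb, Nat.div_eq_of_lt hb, add_zero]
    split_ifs at * <;> omega
  mod := by
    intro x y
    rw [emb_mod hn, emb_mod hn]
    split_ifs <;> omega

variable {n c k : ℕ} {E : ℕ → ℕ}

open Classical in
noncomputable def pull (E : ℕ → ℕ) (hE : StrictMono E) (S : Finset ℕ) : Finset ℕ :=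
  S.preimage E hE.injective.injOn

lemma pull_image (hE : Emb n c E) (T : Finset ℕ) : pull E hE.mono (T.image E) = T := by
  ext x; simp [pull, hE.mono.injective.eq_iff]

lemma pull_insert (hE : Emb n c E) {v : ℕ} (hv : v % (n+1) = c) (T : Finset ℕ) :
    pull E hE.mono (insert v (T.image E)) = T := by
  ext x
  have : E x ≠ v := fun h => hE.ne x (h ▸ hv)
  simp [pull, hE.mono.injective.eq_iff, this]

lemma image_pull (hE : Emb n c E) {S : Finset ℕ} (hS : ∀ x ∈ S, x % (n+1) ≠ c) :
    (pull E hE.mono S).image E = S := by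
  ext x
  simp only [mem_image, pull, mem_preimage]
  constructor
  · rintro ⟨a, ha, rfl⟩; exact ha
  · intro hx; obtain ⟨a, rfl⟩ := hE.surj x (hS x hx); exact ⟨a, hx, rfl⟩

lemma insert_pull (hE : Emb n c E) {S : Finset ℕ} (hS : RB (n+1) k S) {v : ℕ}
    (hv : v % (n+1) = c) (hvS : v ∈ S) :
    insert v ((pull E hE.mono S).image E) = S := by
  ext x
  simp only [mem_insert, mem_image, pull, mem_preimage]
  constructor
  · rintro (rfl | ⟨a, ha, rfl⟩); exacts [hvS, ha]
  · intro hx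
    by_cases h : x % (n+1) = c
    · left; exact hS.2 x hx v hvS (h.trans hv.symm)
    · right; obtain ⟨a, rfl⟩ := hE.surj x h; exact ⟨a, hx, rfl⟩

lemma RB_image (hE : Emb n c E) {T : Finset ℕ} : RB (n+1) k (T.image E) ↔ RB n k T := by
  unfold RB
  rw [card_image_of_injective _ hE.mono.injective]
  simp only [forall_mem_image, hE.mod, hE.mono.injective.eq_iff]

lemma RB_insert_image (hE : Emb n c E) {v : ℕ} (hv : v % (n+1) = c) {T : Finset ℕ} :
    RB (n+1) (k+1) (insert v (T.image E)) ↔ RB n k T := by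
  have hvT : v ∉ T.image E := by
    intro h; obtain ⟨a, _, rfl⟩ := mem_image.1 h; exact hE.ne a hv
  constructor
  · intro h
    have h2 := h.mono (subset_insert v (T.image E))
    have h3 := h.1
    rw [card_insert_of_notMem hvT] at h3
    rw [show (T.image E).card = k by omega] at h2
    exact (RB_image hE).1 h2
  · intro h
    refine ((RB_image hE).2 h).insert ?_
    intro y hy; obtain ⟨a, _, rfl⟩ := mem_image.1 hy; rw [hv]; exact hE.ne a

noncomputable def low (hE : Emb n c E) (G : Finset (Finset ℕ)) : Finset (Finset ℕ) :=
  (G.filter (fun S => ∀ x ∈ S, x % (n+1) ≠ c)).image (pull E hE.mono)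

noncomputable def lnk (hE : Emb n c E) (G : Finset (Finset ℕ)) (v : ℕ) : Finset (Finset ℕ) :=
  (G.filter (fun S => v ∈ S)).image (pull E hE.mono)

lemma mem_low (hE : Emb n c E) {G : Finset (Finset ℕ)} {T : Finset ℕ} :
    T ∈ low hE G ↔ T.image E ∈ G := by
  simp only [low, mem_image, mem_filter]
  constructor
  · rintro ⟨S, ⟨hS, h⟩, rfl⟩; rwa [image_pull hE h]
  · intro h
    refine ⟨_, ⟨h, ?_⟩, pull_image hE T⟩
    intro x hx; obtain ⟨a, _, rfl⟩ := mem_image.1 hx; exact hE.ne a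

lemma mem_lnk (hE : Emb n c E) {G : Finset (Finset ℕ)} (hG : ∀ S ∈ G, RB (n+1) k S) {v : ℕ}
    (hv : v % (n+1) = c) {T : Finset ℕ} :
    T ∈ lnk hE G v ↔ insert v (T.image E) ∈ G := by
  simp only [lnk, mem_image, mem_filter]
  constructor
  · rintro ⟨S, ⟨hS, h⟩, rfl⟩; rwa [insert_pull hE (hG S hS) hv h]
  · intro h
    exact ⟨_, ⟨h, mem_insert_self _ _⟩, pull_insert hE hv T⟩

def cls (n c N : ℕ) : Finset ℕ := (range N).filter (fun v => v % (n+1) = c)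

lemma fib_sum (hE : Emb n c E) {G : Finset (Finset ℕ)} (hG : ∀ S ∈ G, RB (n+1) k S) {N : ℕ}
    (hN : ∀ S ∈ G, ∀ x ∈ S, x % (n+1) = c → x < N) (φ : Finset ℕ → ℕ) :
    ∑ S ∈ G, φ S = ∑ T ∈ low hE G, φ (T.image E) +
      ∑ v ∈ cls n c N, ∑ T ∈ lnk hE G v, φ (insert v (T.image E)) := by
  have h1 : ∑ T ∈ low hE G, φ (T.image E)
      = ∑ S ∈ G.filter (fun S => ∀ x ∈ S, x % (n+1) ≠ c), φ S := by
    unfold low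
    rw [sum_image]
    · refine sum_congr rfl fun S hS => ?_
      rw [image_pull hE (mem_filter.1 hS).2]
    · intro S hS T hT h
      rw [← image_pull hE (mem_filter.1 hS).2, ← image_pull hE (mem_filter.1 hT).2, h]
  have h2 : ∀ v ∈ cls n c N, ∑ T ∈ lnk hE G v, φ (insert v (T.image E))
      = ∑ S ∈ G.filter (fun S => v ∈ S), φ S := by
    intro v hv
    have hv := (mem_filter.1 hv).2
    unfold lnk
    rw [sum_image]
    · refine sum_congr rfl fun S hS => ?_
      have := mem_filter.1 hS
      rw [insert_pull hE (hG S this.1) hv this.2]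
    · intro S hS T hT h
      have hS := mem_filter.1 hS
      have hT := mem_filter.1 hT
      rw [← insert_pull hE (hG S hS.1) hv hS.2, ← insert_pull hE (hG T hT.1) hv hT.2, h]
  rw [h1, sum_congr rfl h2]
  simp only [sum_filter]
  rw [sum_comm, ← sum_add_distrib]
  refine sum_congr rfl fun S hS => ?_
  by_cases h : ∀ x ∈ S, x % (n+1) ≠ c
  · rw [if_pos h, sum_eq_zero, add_zero]
    intro v hv
    rw [if_neg]
    intro hvS; exact h v hvS (mem_filter.1 hv).2
  · rw [if_neg h, zero_add]
    push Not at h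
    obtain ⟨x, hx, hxc⟩ := h
    rw [sum_eq_single x, if_pos hx]
    · intro v hv hvx
      rw [if_neg]
      intro hvS
      exact hvx ((hG S hS).2 v hvS x hx ((mem_filter.1 hv).2.trans hxc.symm))
    · intro hh; exact absurd (mem_filter.2 ⟨mem_range.2 (hN S hS x hx hxc), hxc⟩) hh

lemma shadow_RB {r : ℕ} {G : Finset (Finset ℕ)} (hG : ∀ S ∈ G, RB r (k+1) S) :
    ∀ S ∈ ∂ G, RB r k S := by
  intro S hS
  rw [mem_shadow_iff] at hS
  obtain ⟨T, hT, a, ha, rfl⟩ := hS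
  have := (hG T hT).mono (erase_subset a T)
  rwa [card_erase_of_mem ha, (hG T hT).1] at this

lemma low_shadow (hE : Emb n c E) {G : Finset (Finset ℕ)} (hG : ∀ S ∈ G, RB (n+1) (k+1) S) {N : ℕ}
    (hN : ∀ S ∈ G, ∀ x ∈ S, x % (n+1) = c → x < N) :
    low hE (∂ G) = ∂ (low hE G) ∪ (cls n c N).biUnion (fun v => lnk hE G v) := by
  ext T
  rw [mem_low, mem_union, mem_biUnion, mem_shadow_iff_insert_mem, mem_shadow_iff_insert_mem]
  constructor
  · rintro ⟨a, ha, h⟩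
    by_cases hac : a % (n+1) = c
    · right
      exact ⟨a, mem_filter.2 ⟨mem_range.2 (hN _ h a (mem_insert_self _ _) hac), hac⟩, (mem_lnk hE hG hac).2 h⟩
    · left
      obtain ⟨b, rfl⟩ := hE.surj a hac
      refine ⟨b, fun hb => ha (mem_image_of_mem E hb), ?_⟩
      rw [mem_low, image_insert]; exact h
  · rintro (⟨b, hb, h⟩ | ⟨v, hv, h⟩)
    · rw [mem_low, image_insert] at h
      refine ⟨E b, ?_, h⟩
      rw [mem_image]; rintro ⟨x, hx, hxb⟩; rw [hE.mono.injective hxb] at hx; exact hb hx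
    · have hvc := (mem_filter.1 hv).2
      refine ⟨v, ?_, (mem_lnk hE hG hvc).1 h⟩
      intro h; obtain ⟨a, _, rfl⟩ := mem_image.1 h; exact hE.ne a hvc

lemma lnk_shadow (hE : Emb n c E) {G : Finset (Finset ℕ)} (hG : ∀ S ∈ G, RB (n+1) (k+1) S) {v : ℕ}
    (hv : v % (n+1) = c) : lnk hE (∂ G) v = ∂ (lnk hE G v) := by
  ext T
  rw [mem_lnk hE (shadow_RB hG) hv, mem_shadow_iff_insert_mem, mem_shadow_iff_insert_mem]
  constructor
  · rintro ⟨a, ha, h⟩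
    rw [mem_insert, not_or] at ha
    have hac : a % (n+1) ≠ c := by
      intro hac
      exact ha.1 ((hG _ h).2 a (mem_insert_self _ _) v (by simp) (hac.trans hv.symm))
    obtain ⟨b, rfl⟩ := hE.surj a hac
    refine ⟨b, fun hb => ha.2 (mem_image_of_mem E hb), ?_⟩
    rw [mem_lnk hE hG hv, image_insert, insert_comm]; exact h
  · rintro ⟨b, hb, h⟩
    rw [mem_lnk hE hG hv, image_insert, insert_comm] at h
    refine ⟨E b, ?_, h⟩
    rw [mem_insert, mem_image]; rintro (h | ⟨x, hx, hxb⟩)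
    · exact hE.ne b (h ▸ hv)
    · rw [hE.mono.injective hxb] at hx; exact hb hx

end FFK

namespace FFK
open Finset
open scoped FinsetFamily

/-- the Kruskal–Katona property for `r` colours -/
def KK (r : ℕ) : Prop := ∀ k F I, (∀ S ∈ F, RB r k S) → IsInit r k I → I.card = F.card →
  (∂ I).card ≤ (∂ F).card

/-- minimality of a family -/
def Minl (r k : ℕ) (F : Finset (Finset ℕ)) : Prop := (∀ S ∈ F, RB r k S) ∧
  ∀ F' : Finset (Finset ℕ), (∀ S ∈ F', RB r k S) → F'.card = F.card → (∂ F').card ≤ (∂ F).card →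
    ∑ S ∈ F, wt S ≤ ∑ S ∈ F', wt S

variable {n c k : ℕ} {E : ℕ → ℕ}

lemma compress (hn : 0 < n) (hE : Emb n c E) (IH : KK n) {F : Finset (Finset ℕ)}
    (hF : Minl (n+1) (k+2) F) :
    IsInit n (k+2) (low hE F) ∧ ∀ v, v % (n+1) = c → IsInit n (k+1) (lnk hE F v) := by
  obtain ⟨hFR, hmin⟩ := hF
  obtain ⟨N, hN⟩ : ∃ N, ∀ S ∈ F, ∀ x ∈ S, x < N :=
    ⟨F.sup (fun S => S.sup id) + 1, fun S hS x hx => Nat.lt_succ_of_le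
      (le_trans (le_sup (f := id) hx) (le_sup (f := fun S : Finset ℕ => S.sup id) hS))⟩
  have hlow : ∀ S ∈ low hE F, RB n (k+2) S := fun S hS =>
    (RB_image hE).1 (hFR _ ((mem_low hE).1 hS))
  have hlnk : ∀ v, v % (n+1) = c → ∀ S ∈ lnk hE F v, RB n (k+1) S := fun v hv S hS =>
    (RB_insert_image hE hv).1 (hFR _ ((mem_lnk hE hFR hv).1 hS))
  obtain ⟨I0, hI0, hI0c⟩ := exists_init (low hE F) hlow
  have hex : ∀ v, ∃ I, v % (n+1) = c → IsInit n (k+1) I ∧ I.card = (lnk hE F v).card := by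
    intro v
    by_cases hv : v % (n+1) = c
    · obtain ⟨I, h⟩ := exists_init (lnk hE F v) (hlnk v hv)
      exact ⟨I, fun _ => h⟩
    · exact ⟨∅, fun h => absurd h hv⟩
  choose J hJ using hex
  set V := cls n c N with hV
  have hVc : ∀ v ∈ V, v % (n+1) = c := fun v hv => (mem_filter.1 hv).2
  set F' : Finset (Finset ℕ) := I0.image (fun T => T.image E) ∪
    V.biUnion (fun v => (J v).image (fun T => insert v (T.image E))) with hF'
  have hF'R : ∀ S ∈ F', RB (n+1) (k+2) S := by
    intro S hS
    simp only [hF', mem_union, mem_image, mem_biUnion] at hS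
    rcases hS with ⟨T, hT, rfl⟩ | ⟨v, hv, T, hT, rfl⟩
    · exact (RB_image hE).2 (hI0.1 T hT)
    · exact (RB_insert_image hE (hVc v hv)).2 ((hJ v (hVc v hv)).1.1 T hT)
  have hl' : low hE F' = I0 := by
    ext T
    rw [mem_low]
    simp only [hF', mem_union, mem_image, mem_biUnion]
    constructor
    · rintro (⟨T', hT', h⟩ | ⟨v, hv, T', hT', h⟩)
      · rwa [← image_injective hE.mono.injective h]
      · exfalso
        have : v ∈ T.image E := by rw [← h]; exact mem_insert_self _ _
        obtain ⟨a, _, rfl⟩ := mem_image.1 this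
        exact hE.ne a (hVc _ hv)
    · intro h; exact Or.inl ⟨T, h, rfl⟩
  have hk' : ∀ v ∈ V, lnk hE F' v = J v := by
    intro v hv
    ext T
    rw [mem_lnk hE hF'R (hVc v hv)]
    simp only [hF', mem_union, mem_image, mem_biUnion]
    constructor
    · rintro (⟨T', hT', h⟩ | ⟨u, hu, T', hT', h⟩)
      · exfalso
        have : v ∈ T'.image E := by rw [h]; exact mem_insert_self _ _
        obtain ⟨a, _, rfl⟩ := mem_image.1 this
        exact hE.ne a (hVc _ hv)
      · have huv : u = v := by
          have : u ∈ insert v (T.image E) := by rw [← h]; exact mem_insert_self _ _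
          rw [mem_insert] at this
          rcases this with h | h
          · exact h
          · obtain ⟨a, _, rfl⟩ := mem_image.1 h
            exact absurd (hVc _ hu) (hE.ne a)
        subst huv
        have h3 := pull_insert hE (hVc u hu) T
        rw [← h, pull_insert hE (hVc u hu) T'] at h3
        rwa [← h3]
    · intro h; exact Or.inr ⟨v, hv, T, h, rfl⟩
  have hNF : ∀ S ∈ F, ∀ x ∈ S, x % (n+1) = c → x < N := fun S hS x hx _ => hN S hS x hx
  have hNF' : ∀ S ∈ F', ∀ x ∈ S, x % (n+1) = c → x < N := by
    intro S hS x hx hxc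
    simp only [hF', mem_union, mem_image, mem_biUnion] at hS
    rcases hS with ⟨T, hT, rfl⟩ | ⟨v, hv, T, hT, rfl⟩
    · obtain ⟨a, _, rfl⟩ := mem_image.1 hx
      exact absurd hxc (hE.ne a)
    · rw [mem_insert] at hx
      rcases hx with rfl | hx
      · exact mem_range.1 (mem_filter.1 hv).1
      · obtain ⟨a, _, rfl⟩ := mem_image.1 hx
        exact absurd hxc (hE.ne a)
  have hsh : ∀ G : Finset (Finset ℕ), (∀ S ∈ G, ∀ x ∈ S, x % (n+1) = c → x < N) →
      (∀ S ∈ ∂ G, ∀ x ∈ S, x % (n+1) = c → x < N) := by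
    intro G hG S hS x hx hxc
    rw [mem_shadow_iff] at hS
    obtain ⟨T, hT, a, ha, rfl⟩ := hS
    exact hG T hT x (mem_of_mem_erase hx) hxc
  have hcard : F'.card = F.card := by
    have h1 := fib_sum hE hFR hNF (fun _ => 1)
    have h2 := fib_sum hE hF'R hNF' (fun _ => 1)
    simp only [sum_const, smul_eq_mul, mul_one] at h1 h2
    rw [h1, h2, hl', hI0c]
    congr 1
    refine sum_congr rfl fun v hv => ?_
    rw [hk' v hv, (hJ v (hVc v hv)).2]
  have hshadow : (∂ F').card ≤ (∂ F).card := by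
    have h1 := fib_sum hE (shadow_RB hFR) (hsh F hNF) (fun _ => 1)
    have h2 := fib_sum hE (shadow_RB hF'R) (hsh F' hNF') (fun _ => 1)
    simp only [sum_const, smul_eq_mul, mul_one] at h1 h2
    rw [h1, h2]
    refine add_le_add ?_ (sum_le_sum fun v hv => ?_)
    · rw [low_shadow hE hFR hNF, low_shadow hE hF'R hNF', hl']
      set U := ∂ (low hE F) ∪ (cls n c N).biUnion (fun v => lnk hE F v) with hU
      -- an initial segment of size at most `U.card` containing everything
      have hUR : ∀ S ∈ U, RB n (k+1) S := by
        intro S hS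
        rw [hU, mem_union, mem_biUnion] at hS
        rcases hS with hS | ⟨v, hv, hS⟩
        · exact shadow_RB hlow S hS
        · exact hlnk v (hVc v hv) S hS
      obtain ⟨K, hK, hKc⟩ := exists_init U hUR
      rw [← hKc]
      refine card_le_card (union_subset ?_ (biUnion_subset.2 fun v hv => ?_))
      · refine (hI0.shadow hn).subset hK ?_
        rw [hKc]
        exact (IH _ _ _ hlow hI0 hI0c).trans (card_le_card subset_union_left)
      · rw [hk' v hv]
        refine (hJ v (hVc v hv)).1.subset hK ?_
        rw [hKc, (hJ v (hVc v hv)).2]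
        refine card_le_card (subset_trans ?_ subset_union_right)
        exact subset_biUnion_of_mem (fun v => lnk hE F v) hv
    · rw [lnk_shadow hE hFR (hVc v hv), lnk_shadow hE hF'R (hVc v hv), hk' v hv]
      exact IH _ _ _ (hlnk v (hVc v hv)) (hJ v (hVc v hv)).1 (hJ v (hVc v hv)).2
  have hle := hmin F' hF'R hcard hshadow
  have h1 := fib_sum hE hFR hNF wt
  have h2 := fib_sum hE hF'R hNF' wt
  rw [hl', ← hV] at h2
  rw [← hV] at h1
  have h3 := sum_init_le hI0 hlow hI0c (fun T => wt (T.image E))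
    (fun S T h => (wt_image_lt hE.mono).2 h)
  have h4 : ∀ v ∈ V, _ := fun v hv => sum_init_le (hJ v (hVc v hv)).1 (hlnk v (hVc v hv))
    (hJ v (hVc v hv)).2 (fun T => wt (insert v (T.image E)))
    (fun S T h => by
      have hv' : ∀ T : Finset ℕ, v ∉ T.image E := by
        intro T h; obtain ⟨a, _, rfl⟩ := mem_image.1 h; exact hE.ne a (hVc _ hv)
      rw [wt_insert (hv' S), wt_insert (hv' T)]
      exact Nat.add_lt_add_left ((wt_image_lt hE.mono).2 h) _)
  have h5 : ∑ v ∈ V, ∑ T ∈ lnk hE F' v, wt (insert v (T.image E))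
      = ∑ v ∈ V, ∑ T ∈ J v, wt (insert v (T.image E)) :=
    sum_congr rfl fun v hv => by rw [hk' v hv]
  have h6 : ∑ v ∈ V, ∑ T ∈ J v, wt (insert v (T.image E))
     ≤ ∑ v ∈ V, ∑ T ∈ lnk hE F v, wt (insert v (T.image E)) := sum_le_sum fun v hv => (h4 v hv).1
  have h7 := h3.1
  rw [h5] at h2
  constructor
  · rw [h3.2 (by omega)]; exact hI0
  · intro v hv
    by_cases hvN : v < N
    · have hvV : v ∈ V := mem_filter.2 ⟨mem_range.2 hvN, hv⟩
      have h8 := (sum_eq_sum_iff_of_le (fun v hv => (h4 v hv).1)).1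
        (le_antisymm h6 (by omega)) v hvV
      rw [(h4 v hvV).2 h8.ge]
      exact (hJ v hv).1
    · refine ⟨hlnk v hv, ?_⟩
      intro S T hT
      rw [mem_lnk hE hFR hv] at hT
      exact absurd (hN _ hT v (mem_insert_self _ _)) hvN

lemma minl_sc (hn : 0 < n) (IH : KK n) {F : Finset (Finset ℕ)}
    (hF : Minl (n+1) (k+2) F) {A B : Finset ℕ} (hA : RB (n+1) (k+2) A) (hB : B ∈ F)
    (hlt : wt A < wt B)
    (hs : (∃ v ∈ A, v ∈ B) ∨ ∃ c < n+1, (∀ x ∈ A, x % (n+1) ≠ c) ∧ ∀ x ∈ B, x % (n+1) ≠ c) :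
    A ∈ F := by
  rcases hs with ⟨v, hvA, hvB⟩ | ⟨c, hc, hcA, hcB⟩
  · have hc : v % (n+1) < n + 1 := Nat.mod_lt v (Nat.succ_pos n)
    have hE := emb_emb hn (Nat.lt_succ_iff.1 hc)
    have := (compress hn hE IH hF).2 v rfl
    have hBR := hF.1 B hB
    have hv' : ∀ T : Finset ℕ, v ∉ T.image (emb n (v % (n+1))) := by
      intro T h; obtain ⟨a, _, h'⟩ := mem_image.1 h
      exact hE.ne a (by rw [h'])
    have eA := insert_pull hE hA rfl hvA
    have eB := insert_pull hE hBR rfl hvB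
    rw [← eA, ← mem_lnk hE hF.1 rfl]
    refine this.2 _ (pull _ hE.mono B) ?_ ?_ ?_
    · rw [mem_lnk hE hF.1 rfl, eB]; exact hB
    · rw [← RB_insert_image hE rfl, eA]; exact hA
    · rw [← wt_image_lt hE.mono]
      rw [← eA, ← eB, wt_insert (hv' _), wt_insert (hv' _)] at hlt
      omega
  · have hE := emb_emb hn (Nat.lt_succ_iff.1 hc)
    have := (compress hn hE IH hF).1
    have eA := image_pull hE hcA
    have eB := image_pull hE hcB
    rw [← eA, ← mem_low hE]
    refine this.2 _ (pull _ hE.mono B) ?_ ?_ ?_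
    · rw [mem_low hE, eB]; exact hB
    · rw [← RB_image hE, eA]; exact hA
    · rw [← wt_image_lt hE.mono, eA, eB]; exact hlt
end FFK

namespace FFK
open Finset
open scoped FinsetFamily

lemma mod_gap {r x y : ℕ} (h : x % r = y % r) (hlt : x < y) : x + r ≤ y := by
  have h1 : r ∣ y - x := (Nat.modEq_iff_dvd' hlt.le).1 h
  have h2 := Nat.le_of_dvd (by omega) h1
  omega

lemma mod_sub_r {r x : ℕ} (h : r ≤ x) : (x - r) % r = x % r := by
  rw [← Nat.mod_eq_sub_mod h]

lemma exists_rep {r j : ℕ} (hr : 0 < r) (hj : r ≤ j) (x : ℕ) :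
    ∃ t, j - r ≤ t ∧ t < j ∧ t % r = x % r := by
  have h0 : (j - r + x + (r - 1) * (j - r)) % r = x % r := by
    have : j - r + x + (r - 1) * (j - r) = x + r * (j - r) := by
      obtain ⟨s, rfl⟩ := Nat.exists_eq_succ_of_ne_zero hr.ne'
      simp only [Nat.succ_eq_add_one, Nat.add_sub_cancel]; ring
    rw [this, Nat.add_mul_mod_self_left]
  refine ⟨j - r + (x + (r - 1) * (j - r)) % r, by omega, ?_, ?_⟩
  · have := Nat.mod_lt (x + (r - 1) * (j - r)) hr
    omega
  · rw [Nat.add_mod_mod, ← add_assoc, h0]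

lemma Ico_RB {r m j : ℕ} (hm : m ≤ r) (hj : m ≤ j) : RB r m (Ico (j - m) j) := by
  refine ⟨by rw [Nat.card_Ico]; omega, ?_⟩
  intro x hx y hy h
  rw [mem_Ico] at hx hy
  rcases lt_trichotomy x y with h' | h' | h'
  · have := mod_gap h h'; omega
  · exact h'
  · have := mod_gap h.symm h'; omega

lemma pick_color {r k : ℕ} {S : Finset ℕ} (h : RB r k S) (C : Finset ℕ) (hC : C.card < k) :
    ∃ x ∈ S, ∀ y ∈ C, x % r ≠ y % r := by
  by_contra! hcon
  have h1 : S.image (· % r) ⊆ C.image (· % r) := by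
    intro z hz
    obtain ⟨x, hx, rfl⟩ := mem_image.1 hz
    obtain ⟨y, hy, hxy⟩ := hcon x hx
    exact mem_image.2 ⟨y, hy, hxy.symm⟩
  have h2 := card_le_card h1
  have h3 := card_image_le (s := C) (f := (· % r))
  rw [card_image_of_injOn (fun x hx y hy => h.2 x hx y hy), h.1] at h2
  omega

/-- if the colours of `S` are among those of `C` and `C` is no larger, they coincide -/
lemma hit_color {r k : ℕ} {S C : Finset ℕ} (h : RB r k S) (hC : C.card ≤ k)
    (hsub : ∀ x ∈ S, ∃ y ∈ C, x % r = y % r) : ∀ y ∈ C, ∃ x ∈ S, x % r = y % r := by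
  by_contra! hcon
  obtain ⟨y, hy, hy2⟩ := hcon
  obtain ⟨x, hx, hx2⟩ := pick_color h (C.erase y) (by
    rw [card_erase_of_mem hy]; have := card_pos.2 ⟨y, hy⟩; omega)
  obtain ⟨z, hz, hz2⟩ := hsub x hx
  by_cases hzy : z = y
  · subst hzy; exact hy2 x hx hz2
  · exact hx2 z (mem_erase.2 ⟨hzy, hz⟩) hz2

lemma full_color {r : ℕ} {S : Finset ℕ} (h : RB r r S) (hr : 0 < r) (x : ℕ) :
    ∃ y ∈ S, y % r = x % r := by
  have := hit_color h (C := range r) (by simp) (fun x hx => ⟨x % r, by simp [Nat.mod_lt _ hr], by simp⟩)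
    (x % r) (by simp [Nat.mod_lt _ hr])
  simpa using this

lemma wt_lt_of_max {S T : Finset ℕ} {m : ℕ} (hS : ∀ x ∈ S, x < m) (hm : m ∈ T) : wt S < wt T := by
  have h1 : wt S < wt {m} := by
    refine wt_lt_iff.2 ⟨m, by simp, fun h => lt_irrefl _ (hS m h), fun b hb => ?_⟩
    constructor
    · intro h; have := hS b h; omega
    · intro h; rw [mem_singleton] at h; omega
  refine h1.trans_le ?_
  unfold wt
  exact sum_le_sum_of_subset (singleton_subset_iff.2 hm)

def Share (r : ℕ) (A B : Finset ℕ) : Prop :=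
  (∃ v ∈ A, v ∈ B) ∨ ∃ c < r, (∀ x ∈ A, x % r ≠ c) ∧ ∀ x ∈ B, x % r ≠ c

variable {r k : ℕ}

lemma RB.erase {S : Finset ℕ} (h : RB r k S) {x : ℕ} (hx : x ∈ S) : RB r (k-1) (S.erase x) := by
  have := h.mono (erase_subset x S)
  rwa [card_erase_of_mem hx, h.1] at this

/-- Step 1 : tops -/
lemma step_top (hk : 3 ≤ k) (hkr : k ≤ r) {A B : Finset ℕ} (hA : RB r k A) (hB : RB r k B)
    (hlt : wt A < wt B) (hns : ¬ Share r A B)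
    (hbr : ∀ D, RB r k D → wt A < wt D → wt D < wt B → Share r A D → ¬ Share r D B) :
    ∃ j, j + 1 ∈ B ∧ (∀ x ∈ B, x ≤ j + 1) ∧ j ∈ A ∧ ∀ x ∈ A, x ≤ j := by
  obtain ⟨j, hjB, hjA, hag⟩ := wt_lt_iff.1 hlt
  have hdis : ∀ x ∈ A, x ∉ B := fun x hx hxB => hns (Or.inl ⟨x, hx, hxB⟩)
  have hBj : ∀ x ∈ B, x ≤ j := by
    intro x hx
    by_contra h
    exact hdis x ((hag x (by omega)).2 hx) hx
  have hAj : ∀ x ∈ A, x < j := by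
    intro x hx
    rcases lt_trichotomy x j with h | h | h
    · exact h
    · subst h; exact absurd hx hjA
    · exact absurd ((hag x h).1 hx) (hdis x hx)
  have hkj : k ≤ j := by
    rw [← hA.1, ← card_range j]
    exact card_le_card fun x hx => mem_range.2 (hAj x hx)
  obtain ⟨m, rfl⟩ : ∃ m, j = m + 1 := ⟨j - 1, by omega⟩
  refine ⟨m, hjB, hBj, ?_, fun x hx => by have := hAj x hx; omega⟩
  by_contra hmA
  have hAm : ∀ x ∈ A, x < m := by
    intro x hx
    have := hAj x hx
    rcases (show x ≤ m by omega).eq_or_lt with h | h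
    · subst h; exact absurd hx hmA
    · exact h
  obtain ⟨b, hb, hbm⟩ := pick_color (hB.erase hjB) {m} (by rw [card_singleton]; omega)
  rw [mem_erase] at hb
  obtain ⟨a, ha, ham⟩ := pick_color hA {m, b} (lt_of_le_of_lt card_le_two (by omega))
  simp only [mem_singleton, forall_eq, mem_insert, forall_eq_or_imp] at hbm ham
  have h1 : RB r 1 {m} := ⟨card_singleton m, by simp⟩
  have h2 : RB r 2 {b, m} := h1.insert (by simpa using hbm.symm)
  have h3 : RB r 3 {a, b, m} := h2.insert (by simpa using ⟨ham.2.symm, ham.1.symm⟩)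
  obtain ⟨D, hD1, hD2, hD3⟩ := exists_ext (n := m + 1) hkr hkj h3 hk (by
    intro x hx
    simp only [mem_insert, mem_singleton] at hx
    rcases hx with rfl | rfl | rfl
    · exact hAj _ ha
    · have := hBj _ hb.2; omega
    · omega)
  exact hbr D hD2 (wt_lt_of_max hAm (hD1 (by simp))) (wt_lt_of_max hD3 hjB)
    (Or.inl ⟨a, ha, hD1 (by simp)⟩) (Or.inl ⟨b, hD1 (by simp), hb.2⟩)

/-- Step 3 -/
lemma step_shape (hk : 3 ≤ k) (hkr : k ≤ r) {A B : Finset ℕ} (hA : RB r k A) (hB : RB r k B)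
    (hns : ¬ Share r A B)
    (hbr : ∀ D, RB r k D → wt A < wt D → wt D < wt B → Share r A D → ¬ Share r D B)
    {j : ℕ} (hjB : j ∈ B) (hBj : ∀ x ∈ B, x ≤ j) (hj0 : 0 < j) (hjA : j - 1 ∈ A) (hAj : ∀ x ∈ A, x < j)
    {a : ℕ} (ha : a ∈ A) (hnew : ∀ y < a, ∃ z ∈ A, z ≠ a ∧ z % r = y % r) :
    k = r ∧ 2 * r ≤ j + 1 ∧ (∀ x, j - r < x → x < j → x ∈ A) ∧ (∀ b ∈ B, b ≠ j → b ≤ j - r) ∧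
    ∃ y ∈ A, y % r = j % r ∧ y < r ∧ A = insert y (Ico (j - (r-1)) j) := by
  have hdis : ∀ x ∈ A, x ∉ B := fun x hx hxB => hns (Or.inl ⟨x, hx, hxB⟩)
  have har : a < r := by
    by_contra h
    obtain ⟨z, hz, hza, hz2⟩ := hnew (a - r) (by omega)
    rw [mod_sub_r (by omega)] at hz2
    exact hza (hA.2 z hz a ha hz2)
  have hkj : k ≤ j := by
    rw [← hA.1, ← card_range j]
    exact card_le_card fun x hx => mem_range.2 (hAj x hx)
  have hBlt : ∀ b ∈ B, b ≠ j → b < j := fun b hb hbj => lt_of_le_of_ne (hBj b hb) hbj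
  -- bridging by sets agreeing with A above p
  have hG : ∀ p D, p ∉ A → p ∈ D → RB r k D → (∀ x ∈ D, x < j) → j - 1 ∈ D →
      (∀ x, p < x → x < j → (x ∈ A ↔ x ∈ D)) → ¬ Share r D B := by
    intro p D hpA hpD hD hDj hj1 hag
    refine hbr D hD (wt_lt_iff.2 ⟨p, hpD, hpA, fun x hx => ?_⟩) (wt_lt_of_max hDj hjB)
      (Or.inl ⟨j - 1, hjA, hj1⟩)
    by_cases hxj : x < j
    · exact hag x hx hxj
    · exact ⟨fun h => absurd (hAj x h) hxj, fun h => absurd (hDj x h) hxj⟩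
  -- if B's colours are within the top ones then j ≥ r + 1
  have hbig : (∀ b ∈ B, b ≠ j → ∃ t ∈ Ico (j - (k-1)) j, b % r = t % r) →
      r + 1 ≤ j ∧ ∀ t ∈ Ico (j - (k-1)) j, ∃ b ∈ B, b ≠ j ∧ b % r = t % r := by
    intro h
    have hhit := hit_color (hB.erase hjB) (C := Ico (j - (k-1)) j) (by rw [Nat.card_Ico]; omega)
      (fun x hx => h x (mem_erase.1 hx).2 (mem_erase.1 hx).1)
    refine ⟨?_, fun t ht => ?_⟩
    · obtain ⟨b, hb, hb2⟩ := hhit (j - 1) (by rw [mem_Ico]; omega)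
      rw [mem_erase] at hb
      have h1 := hBlt b hb.2 hb.1
      have h2 : b ≠ j - 1 := by rintro rfl; exact hdis _ hjA hb.2
      have := mod_gap hb2 (by omega)
      omega
    · obtain ⟨b, hb, hb2⟩ := hhit t ht
      rw [mem_erase] at hb
      exact ⟨b, hb.2, hb.1, hb2⟩
  -- D = top ∪ {j - r} has the colours of B
  have hDD : k < r → r + 1 ≤ j → RB r k (insert (j - r) (Ico (j - (k-1)) j)) ∧
      ((∀ b ∈ B, b ≠ j → ∃ t ∈ Ico (j - (k-1)) j, b % r = t % r) →
        Share r (insert (j - r) (Ico (j - (k-1)) j)) B) := by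
    intro hlt hrj
    have hR : RB r k (insert (j - r) (Ico (j - (k-1)) j)) := by
      have := (Ico_RB (r := r) (m := k - 1) (j := j) (by omega) (by omega)).insert (x := j - r) (by
        intro y hy h
        rw [mem_Ico] at hy
        have := mod_gap h.symm (by omega); omega)
      rwa [show k - 1 + 1 = k by omega] at this
    refine ⟨hR, fun h => Or.inr ?_⟩
    obtain ⟨x, _, hx, hx2⟩ := exists_compat (n := r) hR.1 hlt hlt
    rw [Nat.mod_eq_of_lt hx] at hx2
    refine ⟨x, hx, hx2, fun b hb => ?_⟩
    by_cases hbj : b = j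
    · subst hbj
      rw [← mod_sub_r (by omega : r ≤ b)]
      exact hx2 _ (mem_insert_self _ _)
    · obtain ⟨t, ht, ht2⟩ := h b hb hbj
      rw [ht2]; exact hx2 _ (mem_insert_of_mem ht)
  -- top segment
  have hTop : ∀ i, 1 ≤ i → i ≤ k - 1 → j - i ∈ A := by
    by_contra hcon
    push Not at hcon
    have hex : ∃ i, 1 ≤ i ∧ i ≤ k - 1 ∧ j - i ∉ A := hcon
    classical
    obtain ⟨i, ⟨hi1, hik, hiA⟩, himin⟩ : ∃ i, (1 ≤ i ∧ i ≤ k - 1 ∧ j - i ∉ A) ∧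
        ∀ i' < i, ¬ (1 ≤ i' ∧ i' ≤ k - 1 ∧ j - i' ∉ A) :=
      ⟨Nat.find hex, Nat.find_spec hex, fun i' h => Nat.find_min hex h⟩
    have hi2 : 2 ≤ i := by
      by_contra h
      have : i = 1 := by omega
      subst this; exact hiA hjA
    have habove : ∀ x, j - i < x → x < j → x ∈ A := by
      intro x hx1 hx2
      by_contra hxA
      refine himin (j - x) (by omega) ⟨by omega, by omega, ?_⟩
      rwa [show j - (j - x) = x by omega]
    have hno : ∀ b ∈ B, b ≠ j → ∃ t ∈ Ico (j - i) j, b % r = t % r := by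
      by_contra! hcon2
      obtain ⟨b, hb, hbj, hbt⟩ := hcon2
      obtain ⟨D, hD1, hD2, hD3⟩ := exists_ext (n := j) hkr hkj
        ((Ico_RB (r := r) (m := i) (j := j) (by omega) (by omega)).insert (x := b)
          (fun y hy => (hbt y hy).symm)) (by omega) (by
            intro x hx
            rw [mem_insert, mem_Ico] at hx
            rcases hx with rfl | hx
            · exact hBlt _ hb hbj
            · exact hx.2)
      have hD4 : ∀ x, j - i ≤ x → x < j → x ∈ D := fun x h1 h2 =>
        hD1 (mem_insert_of_mem (mem_Ico.2 ⟨h1, h2⟩))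
      refine hG (j - i) D hiA (hD4 _ le_rfl (by omega)) hD2 hD3 (hD4 _ (by omega) (by omega)) ?_
        (Or.inl ⟨b, hD1 (mem_insert_self _ _), hb⟩)
      intro x h1 h2
      exact ⟨fun _ => hD4 x (by omega) h2, fun _ => habove x h1 h2⟩
    have hik' : i = k - 1 := by
      by_contra hne
      obtain ⟨x, hx, hx2⟩ := pick_color (hB.erase hjB) (Ico (j - i) j) (by rw [Nat.card_Ico]; omega)
      rw [mem_erase] at hx
      obtain ⟨t, ht, ht2⟩ := hno x hx.2 hx.1
      exact hx2 t ht ht2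
    subst hik'
    obtain ⟨hrj, hhit⟩ := hbig hno
    rcases hkr.lt_or_eq with hlt | heq
    · obtain ⟨hD, hS⟩ := hDD hlt hrj
      refine hG (j - (k-1)) _ hiA (mem_insert_of_mem (mem_Ico.2 ⟨le_rfl, by omega⟩)) hD ?_
        (mem_insert_of_mem (mem_Ico.2 ⟨by omega, by omega⟩)) ?_ (hS hno)
      · intro x hx
        rw [mem_insert, mem_Ico] at hx
        rcases hx with rfl | hx
        · omega
        · exact hx.2
      · intro x h1 h2
        exact ⟨fun _ => mem_insert_of_mem (mem_Ico.2 ⟨by omega, h2⟩), fun _ => habove x h1 h2⟩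
    · subst heq
      set p := j - (k - 1) with hp
      obtain ⟨b, hb, hbj, hbp⟩ := hhit p (by rw [mem_Ico]; omega)
      have hbj' := hBlt b hb hbj
      have hbp' : b ≠ p ∨ b = p := by tauto
      -- the bridging set
      have hIco : Ico (j - (k-2)) j ⊆ A := fun x hx => by
        rw [mem_Ico] at hx; exact habove x (by omega) hx.2
      by_cases hbp' : b = p
      · -- b = p is itself shared
        obtain ⟨D, hD1, hD2, hD3⟩ := exists_ext (n := j) le_rfl hkj
          (Ico_RB (r := k) (m := k-1) (j := j) (by omega) (by omega)) (by omega) (by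
            intro x hx; exact (mem_Ico.1 hx).2)
        have hD4 : ∀ x, p ≤ x → x < j → x ∈ D := fun x h1 h2 => hD1 (mem_Ico.2 ⟨h1, h2⟩)
        refine hG p D hiA (hD4 _ le_rfl (by omega)) hD2 hD3 (hD4 _ (by omega) (by omega)) ?_
          (Or.inl ⟨p, hD4 _ le_rfl (by omega), hbp' ▸ hb⟩)
        intro x h1 h2
        exact ⟨fun _ => hD4 x (by omega) h2, fun _ => habove x h1 h2⟩
      · have hblt : b + k ≤ p := by
          rcases lt_or_gt_of_ne hbp' with h | h
          · exact mod_gap hbp h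
          · have := mod_gap hbp.symm h; omega
        have hD0 := (Ico_RB (r := k) (m := k - 2) (j := j) (by omega) (by omega)).insert (x := j - k)
          (by
            intro y hy h
            rw [mem_Ico] at hy
            have := mod_gap h.symm (by omega); omega)
        have hD := hD0.insert (x := b) (by
            intro y hy h
            rw [mem_insert, mem_Ico] at hy
            rw [hbp] at h
            rcases hy with rfl | hy
            · have := mod_gap h (by omega); omega
            · have := mod_gap h.symm (by omega); omega)
        rw [show k - 2 + 1 + 1 = k by omega] at hD
        set D := insert b (insert (j - k) (Ico (j - (k-2)) j)) with hDdef
        have hmemD : ∀ x, x ∈ D ↔ x = b ∨ x = j - k ∨ (j - (k-2) ≤ x ∧ x < j) := by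
          intro x; rw [hDdef, mem_insert, mem_insert, mem_Ico]
        have hDj : ∀ x ∈ D, x < j := by
          intro x hx; rw [hmemD] at hx; omega
        have hShare : Share k D B := Or.inl ⟨b, by rw [hmemD]; tauto, hb⟩
        have hj1D : j - 1 ∈ D := by rw [hmemD]; omega
        have hjkA : j - k ∈ A := by
          by_contra hjk
          refine hG (j - k) D hjk (by rw [hmemD]; tauto) hD hDj hj1D ?_ hShare
          intro x h1 h2
          rw [hmemD]
          constructor
          · intro hx
            have : x ≠ p := by rintro rfl; exact hiA hx
            omega
          · rintro (h | h | h)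
            · omega
            · omega
            · exact hIco (mem_Ico.2 h)
        -- remaining elements of A are ≡ p
        have hrest : ∀ x ∈ A, x ≤ p → x ≠ j - k → x % k = p % k := by
          intro x hx hxp hxjk
          obtain ⟨t, ht1, ht2, ht3⟩ := exists_rep (r := k) (j := j) (by omega) (by omega) x
          by_cases htp : t = p
          · rw [← htp, ht3]
          · exfalso
            have htA : t ∈ A := by
              rcases ht1.eq_or_lt with h | h
              · rw [← h]; exact hjkA
              · exact habove t (by omega) ht2
            have := hA.2 t htA x hx ht3
            omega
        obtain ⟨v, hv, hvp⟩ := full_color hA (by omega) p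
        have hvb : ¬ v < b := by
          intro hvb
          refine hG b D (fun h => hdis b h hb) (by rw [hmemD]; tauto) hD hDj hj1D ?_ hShare
          intro x h1 h2
          rw [hmemD]
          constructor
          · intro hx
            by_cases hxp : p < x
            · omega
            by_cases hxjk : x = j - k
            · tauto
            · have := hA.2 x hx v hv ((hrest x hx (by omega) hxjk).trans hvp.symm)
              omega
          · rintro (h | h | h)
            · omega
            · rw [h]; exact hjkA
            · exact hIco (mem_Ico.2 h)
        have hvb' : b < v := by
          rcases lt_trichotomy b v with h | h | h
          · exact h
          · subst h; exact absurd hb (hdis b hv)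
          · exact absurd h hvb
        have hvk := mod_gap (hbp.trans hvp.symm) hvb'
        have hvp' : v < p := by
          by_contra h
          have : v ≠ p := by rintro rfl; exact hiA hv
          have := mod_gap hvp.symm (by omega)
          have := hAj v hv
          omega
        by_cases hap : p < a
        · omega
        by_cases hajk : a = j - k
        · omega
        · have := hA.2 a ha v hv ((hrest a ha (by omega) hajk).trans hvp.symm)
          omega
  have hTop' : ∀ x, j - k < x → x < j → x ∈ A := by
    intro x h1 h2
    have := hTop (j - x) (by omega) (by omega)
    rwa [show j - (j - x) = x by omega] at this
  have hIcoA : Ico (j - (k-1)) j ⊆ A := fun x hx => by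
    rw [mem_Ico] at hx; exact hTop' x (by omega) hx.2
  -- the last element
  obtain ⟨y, hyA, hyI⟩ : ∃ y ∈ A, y ∉ Ico (j - (k-1)) j := by
    by_contra! h
    have := card_le_card (show A ⊆ Ico (j - (k-1)) j from h)
    rw [hA.1, Nat.card_Ico] at this
    omega
  have hyj := hAj y hyA
  rw [mem_Ico] at hyI
  have hAeq : A = insert y (Ico (j - (k-1)) j) := by
    symm
    refine eq_of_subset_of_card_le (insert_subset hyA hIcoA) ?_
    rw [hA.1, card_insert_of_notMem (by rw [mem_Ico]; exact hyI), Nat.card_Ico]; omega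
  have hmemA : ∀ x, x ∈ A ↔ x = y ∨ (j - (k-1) ≤ x ∧ x < j) := by
    intro x; rw [hAeq, mem_insert, mem_Ico]
  have hno : ∀ b ∈ B, b ≠ j → ∃ t ∈ Ico (j - (k-1)) j, b % r = t % r := by
    by_contra! hcon2
    obtain ⟨b, hb, hbj, hbt⟩ := hcon2
    have hbj' := hBlt b hb hbj
    have hbI : ¬ (j - (k-1) ≤ b) := fun h => hbt b (mem_Ico.2 ⟨h, hbj'⟩) rfl
    have hyb : y ≠ b := by rintro rfl; exact hdis _ hyA hb
    have hD := (Ico_RB (r := r) (m := k - 1) (j := j) (by omega) (by omega)).insert (x := b)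
      (fun y hy => (hbt y hy).symm)
    rw [show k - 1 + 1 = k by omega] at hD
    have hby : b < y := by
      by_contra hcon
      refine hG b _ (fun h => hdis b h hb) (mem_insert_self _ _) hD ?_
        (mem_insert_of_mem (mem_Ico.2 (by omega))) ?_ (Or.inl ⟨b, mem_insert_self _ _, hb⟩)
      · intro x hx
        rw [mem_insert, mem_Ico] at hx; omega
      · intro x h1 h2
        rw [hmemA, mem_insert, mem_Ico]; omega
    have hay : y ≤ a := by
      rw [hmemA] at ha; omega
    obtain ⟨z, hz, hza, hz2⟩ := hnew b (by omega)
    rw [hmemA] at hz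
    rcases hz with rfl | hz
    · have := mod_gap hz2.symm hby; omega
    · exact hbt z (mem_Ico.2 hz) hz2.symm
  obtain ⟨hrj, hhit⟩ := hbig hno
  have hkr' : k = r := by
    by_contra hne
    have hlt : k < r := by omega
    obtain ⟨hD, hS⟩ := hDD hlt hrj
    rcases lt_trichotomy y (j - r) with h | h | h
    · refine hG (j - r) _ ?_ (mem_insert_self _ _) hD ?_
        (mem_insert_of_mem (mem_Ico.2 (by omega))) ?_ (hS hno)
      · rw [hmemA]; omega
      · intro x hx
        rw [mem_insert, mem_Ico] at hx; omega
      · intro x h1 h2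
        rw [hmemA, mem_insert, mem_Ico]; omega
    · rw [h] at hAeq
      rw [← hAeq] at hS
      exact hns (hS hno)
    · have hay : y ≤ a := by
        rw [hmemA] at ha; omega
      obtain ⟨z, hz, hza, hz2⟩ := hnew (j - r) (by omega)
      have hzj := hAj z hz
      rw [hmemA] at hz
      have := mod_gap hz2.symm (by omega)
      omega
  subst hkr'
  have hyk : y % k = j % k := by
    obtain ⟨t, ht1, ht2, ht3⟩ := exists_rep (r := k) (j := j) (by omega) (by omega) y
    rcases ht1.eq_or_lt with h | h
    · rw [← ht3, ← h, mod_sub_r (by omega)]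
    · have := hA.2 t (hTop' t h ht2) y hyA ht3
      omega
  have hBle : ∀ b ∈ B, b ≠ j → b ≤ j - k := by
    intro b hb hbj
    by_contra h
    exact hdis b (hTop' b (by omega) (hBlt b hb hbj)) hb
  have h2 : 2 * k ≤ j + 1 := by
    have hsub : B.erase j ⊆ range (j - k) := by
      intro b hb
      rw [mem_erase] at hb
      rw [mem_range]
      refine lt_of_le_of_ne (hBle b hb.2 hb.1) ?_
      rintro rfl
      have := hB.2 _ hb.2 j hjB (mod_sub_r (by omega))
      omega
    have := card_le_card hsub
    rw [(hB.erase hjB).1, card_range] at this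
    omega
  refine ⟨rfl, h2, hTop', hBle, y, hyA, hyk, ?_, hAeq⟩
  rw [hmemA] at ha
  omega
end FFK

namespace FFK
open Finset
open scoped FinsetFamily

lemma mem_sh {F : Finset (Finset ℕ)} {S : Finset ℕ} : S ∈ ∂ F ↔ ∃ T ∈ F, ∃ a ∈ T, T.erase a = S :=
  mem_shadow_iff

lemma main_step {r k : ℕ} (hk : 3 ≤ k) (hkr : k ≤ r) {F : Finset (Finset ℕ)} (hF : Minl r k F)
    (sc : ∀ A B, RB r k A → B ∈ F → wt A < wt B → Share r A B → A ∈ F) : IsInit r k F := by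
  refine ⟨hF.1, ?_⟩
  by_contra hcon
  push Not at hcon
  obtain ⟨A0, B0, hB0, hA0, hlt0, hA0F⟩ := hcon
  -- minimal A
  classical
  have hex : ∃ n, ∃ A, wt A = n ∧ RB r k A ∧ A ∉ F ∧ ∃ B ∈ F, wt A < wt B :=
    ⟨_, A0, rfl, hA0, hA0F, B0, hB0, hlt0⟩
  obtain ⟨n, ⟨A, hAn, hA, hAF, hAB⟩, hmin⟩ : ∃ n, (∃ A, wt A = n ∧ RB r k A ∧ A ∉ F ∧ ∃ B ∈ F, wt A < wt B) ∧
      ∀ n' < n, ¬ (∃ A, wt A = n' ∧ RB r k A ∧ A ∉ F ∧ ∃ B ∈ F, wt A < wt B) :=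
    ⟨Nat.find hex, Nat.find_spec hex, fun i' h => Nat.find_min hex h⟩
  subst hAn
  have hless : ∀ S, RB r k S → wt S < wt A → S ∈ F := by
    intro S hS hlt
    by_contra hSF
    obtain ⟨B, hB, hB2⟩ := hAB
    exact hmin _ hlt ⟨S, rfl, hS, hSF, B, hB, hlt.trans hB2⟩
  have hns : ∀ B ∈ F, wt A < wt B → ¬ Share r A B := fun B hB hlt h => hAF (sc A B hA hB hlt h)
  have hbr : ∀ B ∈ F, wt A < wt B → ∀ D, RB r k D → wt A < wt D → wt D < wt B → Share r A D →
      ¬ Share r D B := fun B hB _ D hD h1 h2 h3 h4 => hns D (sc D B hD hB h2 h4) h1 h3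
  obtain ⟨B, hBF, hBmax⟩ := exists_max_image F wt (by obtain ⟨B, hB, _⟩ := hAB; exact ⟨B, hB⟩)
  have hltB : wt A < wt B := by
    obtain ⟨B', hB', h⟩ := hAB
    exact h.trans_le (hBmax B' hB')
  have hB := hF.1 B hBF
  obtain ⟨m, hmB, hBm, hmA, hAm⟩ := step_top hk hkr hA hB hltB (hns B hBF hltB) (hbr B hBF hltB)
  have hall : ∀ T ∈ F, wt A < wt T → m + 1 ∈ T := by
    intro T hT hlt
    obtain ⟨m', h1, h2, h3, h4⟩ := step_top hk hkr hA (hF.1 T hT) hlt (hns T hT hlt) (hbr T hT hlt)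
    have := hAm _ h3
    have := h4 _ hmA
    rwa [show m = m' by omega]
  -- new element
  have hnew : ∃ a ∈ A, ∀ y < a, ∃ z ∈ A, z ≠ a ∧ z % r = y % r := by
    by_contra! hno
    have hAe : A ∉ F.erase B := fun h => hAF (mem_erase.1 h).2
    have hcard : (insert A (F.erase B)).card = F.card := by
      rw [card_insert_of_notMem hAe, card_erase_of_mem hBF]
      have := card_pos.2 ⟨B, hBF⟩; omega
    have h := hF.2 (insert A (F.erase B)) (by
      intro S hS
      rw [mem_insert] at hS
      rcases hS with rfl | hS
      · exact hA
      · exact hF.1 S (mem_erase.1 hS).2) hcard (card_le_card (by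
      intro S hS
      obtain ⟨T, hT, a, ha, rfl⟩ := mem_sh.1 hS
      rw [mem_insert] at hT
      rcases hT with rfl | hT
      · obtain ⟨y, hy, hy2⟩ := hno a ha
        have hyn : y ∉ T.erase a := fun h => hy2 y (mem_erase.1 h).2 (mem_erase.1 h).1 rfl
        refine mem_sh.2 ⟨insert y (T.erase a), ?_, y, mem_insert_self _ _, erase_insert hyn⟩
        refine hless _ ?_ ?_
        · have := (hA.erase ha).insert (x := y) (fun z hz => hy2 z (mem_erase.1 hz).2 (mem_erase.1 hz).1)
          rwa [show k - 1 + 1 = k by omega] at this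
        · conv_rhs => rw [← insert_erase ha]
          rw [wt_insert hyn, wt_insert (notMem_erase _ _)]
          have := Nat.pow_lt_pow_right (a := 2) (by norm_num) hy
          omega
      · exact mem_sh.2 ⟨T, (mem_erase.1 hT).2, a, ha, rfl⟩))
    rw [sum_insert hAe, ← add_sum_erase F wt hBF] at h
    omega
  obtain ⟨a, ha, hnew⟩ := hnew
  obtain ⟨hkr', h2r, -, hBlow, y, hyA, hyj, hyr, hAeq⟩ := step_shape hk hkr hA hB (hns B hBF hltB) (hbr B hBF hltB)
    hmB hBm (by omega) (by simpa using hmA) (fun x hx => by have := hAm x hx; omega) ha hnew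
  subst hkr'
  set j := m + 1 with hj
  set X := Ico (j - (k-1)) j with hX
  have hmX : ∀ x, x ∈ X ↔ j - (k-1) ≤ x ∧ x < j := fun x => by rw [hX, mem_Ico]
  obtain ⟨b, hb⟩ : (B.erase j).Nonempty := by
    rw [← card_pos, card_erase_of_mem hmB, hB.1]; omega
  obtain ⟨hbj, hbB⟩ := mem_erase.1 hb
  have hbl := hBlow b hbB hbj
  set L := B.erase b with hL
  have hjL : j ∈ L := mem_erase.2 ⟨hbj.symm, hmB⟩
  have hLR := hB.erase hbB
  rw [← hL] at hLR
  set R := F.filter (L ⊆ ·) with hR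
  have hBR : B ∈ R := mem_filter.2 ⟨hBF, erase_subset _ _⟩
  have hRF : R ⊆ F := filter_subset _ _
  set C := (range j).filter (fun x => x % k = j % k) with hC
  have hRsub : R ⊆ ((range (j - k + 1)).filter (fun x => x % k = b % k)).image (fun x => insert x L) := by
    intro T hT
    obtain ⟨hTF, hLT⟩ := mem_filter.1 hT
    have hTR := hF.1 T hTF
    obtain ⟨x, hxT, hxb⟩ := full_color hTR (by omega) b
    have hxL : x ∉ L := by
      intro h
      have h1 := (mem_erase.1 h)
      exact h1.1 (hB.2 x h1.2 b hbB hxb)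
    have hTeq : insert x L = T := by
      refine eq_of_subset_of_card_le (insert_subset hxT hLT) ?_
      rw [card_insert_of_notMem hxL, hLR.1, hTR.1]; omega
    refine mem_image.2 ⟨x, mem_filter.2 ⟨?_, hxb⟩, hTeq⟩
    have h1 := hBmax T hTF
    have h3 : wt B = 2 ^ b + wt L := by
      rw [← wt_insert (notMem_erase b B), insert_erase hbB]
    rw [← hTeq, h3, wt_insert hxL] at h1
    have h2 := (Nat.pow_le_pow_iff_right (a := 2) (by norm_num)).1 (show 2 ^ x ≤ 2 ^ b by omega)
    rw [mem_range]; omega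
  have hRC : R.card ≤ C.card := by
    refine (card_le_card hRsub).trans (card_image_le.trans ?_)
    refine card_le_card_of_injOn (fun x => x + (j - b) % k) ?_ (fun x _ y _ h => by simpa using h)
    intro x hx
    have hx' := mem_filter.1 hx
    rw [mem_range] at hx'
    have hmod := Nat.mod_lt (j - b) (show 0 < k by omega)
    simp only [hC, coe_filter, Set.mem_ofPred_eq, mem_range]
    refine ⟨by omega, ?_⟩
    rw [Nat.add_mod_mod, Nat.add_mod, hx'.2, ← Nat.add_mod]
    congr 1; omega
  obtain ⟨C', hC'C, hC'card⟩ := exists_subset_card_eq hRC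
  have hCprop : ∀ y' ∈ C', y' ≤ j - k ∧ y' % k = j % k := by
    intro y' hy'
    have h := mem_filter.1 (hC'C hy')
    rw [mem_range] at h
    have := mod_gap h.2 h.1
    exact ⟨by omega, h.2⟩
  have hCX : ∀ y' ∈ C', y' ∉ X := by
    intro y' hy' h
    have := hCprop y' hy'
    rw [hmX] at h; omega
  have hXR : RB k (k-1) X := Ico_RB (by omega) (by omega)
  have hjX : ∀ x ∈ X, j % k ≠ x % k := by
    intro x hx h
    rw [hmX] at hx
    have := mod_gap h.symm hx.2; omega
  set Add := C'.image (fun y' => insert y' X) with hAdd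
  have hAddcard : Add.card = C'.card := by
    refine card_image_of_injOn ?_
    intro x hx z hz h
    have : x ∈ insert z X := by simp only at h; rw [← h]; exact mem_insert_self _ _
    rw [mem_insert] at this
    rcases this with h | h
    · exact h
    · exact absurd h (hCX x hx)
  have hAddRB : ∀ S ∈ Add, RB k k S := by
    intro S hS
    obtain ⟨y', hy', rfl⟩ := mem_image.1 hS
    have := hXR.insert (x := y') (fun x hx h => hjX x hx (by rw [h, (hCprop y' hy').2]))
    rwa [show k - 1 + 1 = k by omega] at this
  have hAddlt : ∀ S ∈ Add, ∀ x ∈ S, x < j := by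
    intro S hS x hx
    obtain ⟨y', hy', rfl⟩ := mem_image.1 hS
    rw [mem_insert, hmX] at hx
    have := hCprop y' hy'
    omega
  have hyX : y ∉ X := by rw [hmX]; omega
  have hAddF : ∀ S ∈ Add, S ∉ F := by
    intro S hS hSF
    have hltj := hAddlt S hS
    obtain ⟨y', hy', rfl⟩ := mem_image.1 hS
    have hyy : y ≤ y' := by
      by_contra h
      have := mod_gap ((hCprop y' hy').2.trans hyj.symm) (by omega)
      omega
    rcases hyy.eq_or_lt with h | h
    · subst h; rw [← hAeq] at hSF; exact hAF hSF
    · have h1 : wt A < wt (insert y' X) := by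
        rw [hAeq, wt_insert hyX, wt_insert (hCX y' hy')]
        have := Nat.pow_lt_pow_right (a := 2) (by norm_num) h
        omega
      exact lt_irrefl _ (hltj j (hall _ hSF h1))
  have hdisj : Disjoint (F \ R) Add := by
    rw [disjoint_left]
    intro S hS hS2
    exact hAddF S hS2 (mem_sdiff.1 hS).1
  have hcard : ((F \ R) ∪ Add).card = F.card := by
    rw [card_union_of_disjoint hdisj, card_sdiff_of_subset hRF, hAddcard, hC'card]
    have := card_le_card hRF; omega
  have hLsh : L ∈ ∂ F := mem_sh.2 ⟨B, hBF, b, hbB, rfl⟩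
  have hsh : ∂ ((F \ R) ∪ Add) ⊆ insert X ((∂ F).erase L) := by
    intro S hS
    obtain ⟨T, hT, t, ht, rfl⟩ := mem_sh.1 hS
    rw [mem_insert]
    rcases mem_union.1 hT with hT | hT
    · right
      obtain ⟨hTF, hTR⟩ := mem_sdiff.1 hT
      refine mem_erase.2 ⟨fun h => hTR (mem_filter.2 ⟨hTF, ?_⟩), mem_sh.2 ⟨T, hTF, t, ht, rfl⟩⟩
      rw [← h]; exact erase_subset _ _
    · have hTlt := hAddlt T hT
      have hTRB := hAddRB T hT
      obtain ⟨y', hy', rfl⟩ := mem_image.1 hT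
      have hy'2 := hCprop y' hy'
      have hy'X := hCX y' hy'
      by_cases hty : t = y'
      · left; rw [hty, erase_insert hy'X]
      · right
        have htX : t ∈ X := by
          rw [mem_insert] at ht; tauto
        have htX' := (hmX t).1 htX
        refine mem_erase.2 ⟨fun h => ?_, ?_⟩
        · have : j ∈ (insert y' X).erase t := by rw [h]; exact hjL
          exact lt_irrefl _ (hTlt j (mem_erase.1 this).2)
        · have hrk : k ≤ t := by omega
          have hcomp : ∀ z ∈ (insert y' X).erase t, z % k ≠ (t - k) % k := by
            intro z hz h
            rw [mod_sub_r hrk] at h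
            exact (mem_erase.1 hz).1 (hTRB.2 z (mem_erase.1 hz).2 t ht h)
          have hn : t - k ∉ (insert y' X).erase t := fun h => hcomp _ h rfl
          refine mem_sh.2 ⟨insert (t - k) ((insert y' X).erase t), ?_, t - k, mem_insert_self _ _, erase_insert hn⟩
          refine hless _ ?_ ?_
          · have := (hTRB.erase ht).insert hcomp
            rwa [show k - 1 + 1 = k by omega] at this
          · refine wt_lt_iff.2 ⟨t, ?_, ?_, ?_⟩
            · rw [hAeq]; exact mem_insert_of_mem htX
            · rw [mem_insert, mem_erase]; omega
            · intro x hx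
              rw [hAeq, mem_insert, mem_erase, mem_insert, mem_insert, hmX]
              omega
  have h := hF.2 ((F \ R) ∪ Add) (by
    intro S hS
    rcases mem_union.1 hS with hS | hS
    · exact hF.1 S (mem_sdiff.1 hS).1
    · exact hAddRB S hS) hcard (by
    refine (card_le_card hsh).trans ((card_insert_le _ _).trans ?_)
    rw [card_erase_of_mem hLsh]
    have := card_pos.2 ⟨L, hLsh⟩; omega)
  rw [sum_union hdisj, ← sum_sdiff hRF] at h
  have h1 : ∑ S ∈ Add, wt S < ∑ S ∈ R, wt S := by
    have hlt : ∀ S ∈ Add, wt S < 2 ^ j := by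
      intro S hS
      have := wt_lt_of_max (hAddlt S hS) (mem_singleton_self j)
      simpa [wt] using this
    have hge : ∀ T ∈ R, 2 ^ j ≤ wt T := by
      intro T hT
      exact single_le_sum (f := fun i => 2 ^ i) (fun _ _ => Nat.zero_le _) ((mem_filter.1 hT).2 hjL)
    have hAne : Add.Nonempty := by
      rw [← card_pos, hAddcard, hC'card]; exact card_pos.2 ⟨B, hBR⟩
    calc ∑ S ∈ Add, wt S < ∑ S ∈ Add, 2 ^ j := sum_lt_sum_of_nonempty hAne hlt
      _ = ∑ T ∈ R, 2 ^ j := by rw [sum_const, sum_const, hAddcard, hC'card]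
      _ ≤ _ := sum_le_sum hge
  omega

end FFK

namespace FFK
open Finset
open scoped FinsetFamily

lemma turan_edges (r n : ℕ) : (SimpleGraph.turanGraph n r).edgeFinset.card ≤ (allRB r 2 n).card := by
  refine card_le_card_of_injOn (fun z => z.toFinset.map Fin.valEmbedding) ?_ ?_
  · intro z hz
    induction z with
    | h a b =>
      rw [mem_coe, SimpleGraph.mem_edgeFinset, SimpleGraph.mem_edgeSet, SimpleGraph.turanGraph_adj] at hz
      rw [mem_coe, mem_allRB]
      beta_reduce
      rw [Sym2.toFinset_mk_eq]
      have hab : a ≠ b := by rintro rfl; exact hz rfl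
      refine ⟨⟨by rw [card_map, card_pair hab], ?_⟩, ?_⟩
      · intro x hx y hy h
        simp only [map_insert, map_singleton, mem_insert, mem_singleton, Fin.valEmbedding_apply] at hx hy
        rcases hx with rfl | rfl <;> rcases hy with rfl | rfl
        · rfl
        · exact absurd h hz
        · exact absurd h.symm hz
        · rfl
      · intro x hx
        obtain ⟨y, _, rfl⟩ := mem_map.1 hx
        exact y.2
  · intro z _ w _ h
    have h' := map_injective _ h
    refine Sym2.ext fun x => ?_
    rw [← Sym2.mem_toFinset, h', Sym2.mem_toFinset]

lemma turan_bound {r : ℕ} (hr : 0 < r) {F : Finset (Finset ℕ)} (hF : ∀ S ∈ F, RB r 2 S) :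
    F.card ≤ (allRB r 2 (F.biUnion id).card).card := by
  classical
  set V := F.biUnion id with hV
  set n := V.card with hn
  let e := V.orderEmbOfFin hn.symm
  let G : SimpleGraph (Fin n) :=
    { Adj := fun i j => {e i, e j} ∈ F ∧ i ≠ j
      symm := ⟨fun i j h => ⟨by rw [pair_comm]; exact h.1, h.2.symm⟩⟩
      loopless := ⟨fun i h => h.2 rfl⟩ }
  have hcol : G.Colorable r := by
    refine ⟨SimpleGraph.Coloring.mk (fun i => ⟨e i % r, Nat.mod_lt _ hr⟩) ?_⟩
    intro i j hij h
    have h1 := (hF _ hij.1).2 (e i) (by simp) (e j) (by simp) (by simpa using h)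
    exact hij.2 (e.injective h1)
  have hcf : G.CliqueFree (r + 1) := hcol.cliqueFree (Nat.lt_succ_self r)
  have h1 : G.edgeFinset.card ≤ (SimpleGraph.turanGraph n r).edgeFinset.card :=
    (SimpleGraph.isTuranMaximal_turanGraph hr).2 hcf
  refine le_trans ?_ (h1.trans (turan_edges r n))
  refine card_le_card_of_surjOn (fun z => z.toFinset.map e.toEmbedding) ?_
  intro S hS
  rw [mem_coe] at hS
  obtain ⟨x, y, hxy, rfl⟩ := card_eq_two.1 (hF S hS).1
  have hmem : ∀ z ∈ ({x, y} : Finset ℕ), ∃ i, e i = z := by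
    intro z hz
    have hz' : z ∈ V := mem_biUnion.2 ⟨_, hS, hz⟩
    have := range_orderEmbOfFin V hn.symm
    have h2 : z ∈ Set.range (V.orderEmbOfFin hn.symm) := by rw [this]; exact hz'
    exact h2
  obtain ⟨i, rfl⟩ := hmem x (by simp)
  obtain ⟨j, rfl⟩ := hmem y (by simp)
  refine ⟨s(i, j), ?_, ?_⟩
  · rw [mem_coe, SimpleGraph.mem_edgeFinset, SimpleGraph.mem_edgeSet]
    exact ⟨hS, fun h => hxy (by rw [h])⟩
  · simp [Sym2.toFinset_mk_eq]

lemma kk_two {r : ℕ} (hr : 0 < r) {F I : Finset (Finset ℕ)} (hF : ∀ S ∈ F, RB r 2 S)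
    (hI : IsInit r 2 I) (hc : I.card = F.card) : (∂ I).card ≤ (∂ F).card := by
  have hsub := hI.subset (allRB_init r 2 (F.biUnion id).card) (hc ▸ turan_bound hr hF)
  have h1 : (∂ I).card ≤ (F.biUnion id).card := by
    have : ∂ I ⊆ (range (F.biUnion id).card).image (fun x => ({x} : Finset ℕ)) := by
      intro S hS
      obtain ⟨T, hT, a, ha, rfl⟩ := mem_sh.1 hS
      obtain ⟨h2, h3⟩ := mem_allRB.1 (hsub hT)
      have h4 : (T.erase a).card = 1 := by rw [card_erase_of_mem ha, h2.1]
      obtain ⟨x, hx⟩ := card_eq_one.1 h4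
      refine mem_image.2 ⟨x, mem_range.2 (h3 x (mem_of_mem_erase (by rw [hx]; simp : x ∈ T.erase a))), hx.symm⟩
    simpa using (card_le_card this).trans card_image_le
  refine h1.trans ?_
  refine card_le_card_of_injOn (fun x => ({x} : Finset ℕ)) ?_ (fun x _ y _ h => by simpa using h)
  intro x hx
  obtain ⟨S, hS, hxS⟩ := mem_biUnion.1 hx
  rw [id] at hxS
  obtain ⟨y, hy⟩ := card_eq_one.1 (show (S.erase x).card = 1 by
    rw [card_erase_of_mem hxS, (hF S hS).1])
  have hyS : y ∈ S.erase x := by rw [hy]; simp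
  rw [mem_erase] at hyS
  refine mem_sh.2 ⟨S, hS, y, hyS.2, ?_⟩
  have hx2 : x ∈ S.erase y := mem_erase.2 ⟨hyS.1.symm, hxS⟩
  symm
  refine eq_of_subset_of_card_le (singleton_subset_iff.2 hx2) ?_
  rw [card_erase_of_mem hyS.2, (hF S hS).1]; simp

lemma kk_of_minl {r k : ℕ} (hmin : ∀ F I, Minl r k F → IsInit r k I → I.card = F.card →
    (∂ I).card ≤ (∂ F).card) : ∀ (N : ℕ) (F I : Finset (Finset ℕ)), ∑ S ∈ F, wt S = N →
    (∀ S ∈ F, RB r k S) → IsInit r k I → I.card = F.card → (∂ I).card ≤ (∂ F).card := by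
  intro N
  induction N using Nat.strong_induction_on with
  | _ N ih =>
    intro F I hN hF hI hc
    by_cases h : Minl r k F
    · exact hmin F I h hI hc
    · have : ∃ F' : Finset (Finset ℕ), (∀ S ∈ F', RB r k S) ∧ F'.card = F.card ∧
          (∂ F').card ≤ (∂ F).card ∧ ∑ S ∈ F', wt S < ∑ S ∈ F, wt S := by
        by_contra! h'
        exact h ⟨hF, h'⟩
      obtain ⟨F', h1, h2, h3, h4⟩ := this
      exact (ih _ (hN ▸ h4) F' I rfl h1 hI (hc.trans h2.symm)).trans h3

lemma kk_zero {r k : ℕ} (hr : 0 < r) (hk : k ≤ 2) {F I : Finset (Finset ℕ)} (hF : ∀ S ∈ F, RB r k S)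
    (hI : IsInit r k I) (hc : I.card = F.card) : (∂ I).card ≤ (∂ F).card := by
  by_cases hF0 : F.card = 0
  · rw [hF0, card_eq_zero] at hc; subst hc; simp
  obtain ⟨S, hS⟩ := card_pos.1 (Nat.pos_of_ne_zero hF0)
  interval_cases k
  · have : ∂ I = ∅ := by
      rw [eq_empty_iff_forall_notMem]
      intro T hT
      obtain ⟨T', hT', a, ha, _⟩ := mem_sh.1 hT
      have := (hI.1 T' hT').1
      rw [card_eq_zero] at this; subst this; simp at ha
    rw [this]; simp
  · have h1 : ∂ I ⊆ {∅} := by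
      intro T hT
      obtain ⟨T', hT', a, ha, rfl⟩ := mem_sh.1 hT
      rw [mem_singleton, ← card_eq_zero, card_erase_of_mem ha, (hI.1 T' hT').1]
    refine (card_le_card h1).trans ?_
    rw [card_singleton, Nat.one_le_iff_ne_zero, ← Nat.pos_iff_ne_zero, card_pos]
    obtain ⟨x, hx⟩ := card_pos.1 (show 0 < S.card by rw [(hF S hS).1]; norm_num)
    exact ⟨_, mem_sh.2 ⟨S, hS, x, hx, rfl⟩⟩
  · exact kk_two hr hF hI hc

lemma kk_all : ∀ r, 0 < r → KK r := by
  intro r hr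
  induction r with
  | zero => omega
  | succ n ih =>
    intro k F I hF hI hc
    by_cases hk : k ≤ 2
    · exact kk_zero hr hk hF hI hc
    by_cases hF0 : F.card = 0
    · rw [hF0, card_eq_zero] at hc; subst hc; simp
    obtain ⟨S, hS⟩ := card_pos.1 (Nat.pos_of_ne_zero hF0)
    have hkr : k ≤ n + 1 := (hF S hS).le hr
    refine kk_of_minl ?_ _ F I rfl hF hI hc
    intro F I hF hI hc
    obtain ⟨l, rfl⟩ : ∃ l, k = l + 2 := ⟨k - 2, by omega⟩
    have hn : 0 < n := by omega
    have hinit := main_step (by omega) hkr hF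
      (fun A B hA hB hlt hs => minl_sc hn (ih hn) hF hA hB hlt hs)
    exact card_le_card (shadow_monotone (hI.subset hinit hc.le))

end FFK

namespace FFK
open Finset
open scoped FinsetFamily

lemma turanCount_eq (n k r : ℕ) : turanCount n k r = (allRB r k n).card := by
  unfold turanCount
  refine card_bij (fun s _ => s.map Fin.valEmbedding) ?_ ?_ ?_
  · intro s hs
    rw [SimpleGraph.mem_cliqueFinset_iff, SimpleGraph.isNClique_iff] at hs
    rw [mem_allRB]
    refine ⟨⟨by rw [card_map, hs.2], ?_⟩, ?_⟩
    · intro x hx y hy h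
      obtain ⟨a, ha, rfl⟩ := mem_map.1 hx
      obtain ⟨b, hb, rfl⟩ := mem_map.1 hy
      by_contra hne
      exact hs.1 ha hb (fun h' => hne (by rw [h'])) h
    · intro x hx
      obtain ⟨a, _, rfl⟩ := mem_map.1 hx
      exact a.2
  · intro s _ t _ h
    exact map_injective _ h
  · intro S hS
    obtain ⟨h1, h2⟩ := mem_allRB.1 hS
    have himg : (univ.filter (fun i : Fin n => (i : ℕ) ∈ S)).map Fin.valEmbedding = S := by
      ext x
      simp only [mem_map, mem_filter, mem_univ, true_and, Fin.valEmbedding_apply]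
      constructor
      · rintro ⟨a, ha, rfl⟩; exact ha
      · intro hx; exact ⟨⟨x, h2 x hx⟩, hx, rfl⟩
    refine ⟨univ.filter (fun i : Fin n => (i : ℕ) ∈ S), ?_, himg⟩
    rw [SimpleGraph.mem_cliqueFinset_iff, SimpleGraph.isNClique_iff]
    refine ⟨?_, ?_⟩
    · intro a ha b hb hab
      rw [SimpleGraph.turanGraph_adj]
      intro h
      simp only [coe_filter, mem_univ, true_and, Set.mem_ofPred_eq] at ha hb
      exact hab (Fin.ext (h1.2 _ ha _ hb h))
    · rw [← card_map Fin.valEmbedding, himg, h1.1]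

lemma le_of_wt_lt {S W : Finset ℕ} {m : ℕ} (h : wt S < wt W) (hW : ∀ x ∈ W, x ≤ m) :
    ∀ x ∈ S, x ≤ m := by
  intro x hx
  by_contra hxm
  have := wt_lt_of_max (S := W) (m := x) (fun y hy => by have := hW y hy; omega) hx
  omega

/-- rainbow `k`-sets before `W` -/
def bel (r k m : ℕ) (W : Finset ℕ) : Finset (Finset ℕ) :=
  (allRB r k (m + 1)).filter (fun S => wt S < wt W)

lemma mem_bel {r k m : ℕ} {W : Finset ℕ} (hW : ∀ x ∈ W, x ≤ m) {S : Finset ℕ} :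
    S ∈ bel r k m W ↔ RB r k S ∧ wt S < wt W := by
  unfold bel
  rw [mem_filter, mem_allRB]
  constructor
  · rintro ⟨⟨h1, _⟩, h2⟩; exact ⟨h1, h2⟩
  · rintro ⟨h1, h2⟩
    exact ⟨⟨h1, fun x hx => Nat.lt_succ_of_le (le_of_wt_lt h2 hW x hx)⟩, h2⟩

lemma cascade : ∀ (s r : ℕ) (f : Fin (s + 1) → ℕ), s < r →
    (∀ i : Fin s, f i.succ < f i.castSucc - f i.castSucc / (r - (i : ℕ))) →
    ∃ W : Finset ℕ, RB r (s + 1) W ∧ (∀ x ∈ W, x ≤ f 0) ∧ f 0 ∈ W ∧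
      ∀ k, s ≤ k → (bel r k (f 0) W).card =
        ∑ i : Fin (s + 1), turanCount (f i) (k - (i : ℕ)) (r - (i : ℕ)) := by
  intro s
  induction s with
  | zero =>
    intro r f hr _
    refine ⟨{f 0}, ⟨by simp, by simp⟩, by simp, by simp, ?_⟩
    intro k _
    rw [Fin.sum_univ_one, turanCount_eq]
    congr 1
    ext S
    rw [mem_bel (by simp), mem_allRB]
    simp only [Fin.val_zero, Nat.sub_zero]
    refine and_congr_right fun hS => ?_
    constructor
    · intro h x hx
      refine lt_of_le_of_ne (le_of_wt_lt h (by simp) x hx) ?_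
      rintro rfl
      have : wt {f 0} ≤ wt S := by
        unfold wt
        exact sum_le_sum_of_subset (singleton_subset_iff.2 hx)
      omega
    · intro h
      exact wt_lt_of_max h (mem_singleton_self _)
  | succ s ih =>
    intro r f hr hdec
    obtain ⟨n, rfl⟩ : ∃ n, r = n + 1 := ⟨r - 1, by omega⟩
    have hn : 0 < n := by omega
    obtain ⟨W', hW', hW'le, hW'0, hW'c⟩ := ih n (fun i => f i.succ) (by omega) (by
      intro i
      have := hdec i.succ
      rw [Fin.val_succ, show n + 1 - ((i : ℕ) + 1) = n - i by omega, ← Fin.succ_castSucc] at this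
      exact this)
    set v := f 0 with hv
    have hE : Emb n (v % (n+1)) (emb n (v % (n+1))) :=
      emb_emb hn (Nat.lt_succ_iff.1 (Nat.mod_lt v (Nat.succ_pos n)))
    set E := emb n (v % (n+1)) with hEdef
    have hf1 : f (Fin.succ 0) < v - v / (n + 1) := by
      have := hdec 0
      simpa using this
    have hElt : ∀ x ∈ W'.image E, x < v := by
      intro x hx
      obtain ⟨y, hy, rfl⟩ := mem_image.1 hx
      rw [hEdef, emb_lt_iff hn]
      have := hW'le y hy
      omega
    have hni : ∀ T : Finset ℕ, v ∉ T.image E := by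
      intro T h
      obtain ⟨y, _, hy⟩ := mem_image.1 h
      exact hE.ne y (by rw [hy])
    have hWle : ∀ x ∈ insert v (W'.image E), x ≤ v := by
      intro x hx
      rw [mem_insert] at hx
      rcases hx with rfl | hx
      · exact le_rfl
      · exact (hElt x hx).le
    have hiff : ∀ T : Finset ℕ, wt (insert v (T.image E)) < wt (insert v (W'.image E)) ↔ wt T < wt W' := by
      intro T
      rw [wt_insert (hni T), wt_insert (hni W'), Nat.add_lt_add_iff_left, wt_image_lt hE.mono]
    refine ⟨insert v (W'.image E), (RB_insert_image hE rfl).2 hW', hWle, mem_insert_self _ _, ?_⟩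
    intro k hk
    obtain ⟨l, rfl⟩ : ∃ l, k = l + 1 := ⟨k - 1, by omega⟩
    have hset : bel (n+1) (l+1) v (insert v (W'.image E)) = allRB (n+1) (l+1) v ∪
        (bel n l (f (Fin.succ 0)) W').image (fun T => insert v (T.image E)) := by
      ext S
      rw [mem_bel hWle, mem_union, mem_allRB, mem_image]
      constructor
      · rintro ⟨h1, h2⟩
        have hle := le_of_wt_lt h2 hWle
        by_cases hvS : v ∈ S
        · right
          have hp := insert_pull hE h1 rfl hvS
          refine ⟨pull E hE.mono S, ?_, hp⟩
          rw [mem_bel hW'le]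
          rw [← hp] at h1 h2
          exact ⟨(RB_insert_image hE rfl).1 h1, (hiff _).1 h2⟩
        · left
          refine ⟨h1, fun x hx => lt_of_le_of_ne (hle x hx) ?_⟩
          rintro rfl; exact hvS hx
      · rintro (⟨h1, h2⟩ | ⟨T, hT, rfl⟩)
        · exact ⟨h1, wt_lt_of_max h2 (mem_insert_self _ _)⟩
        · rw [mem_bel hW'le] at hT
          exact ⟨(RB_insert_image hE rfl).2 hT.1, (hiff T).2 hT.2⟩
    have hdisj : Disjoint (allRB (n+1) (l+1) v)
        ((bel n l (f (Fin.succ 0)) W').image (fun T => insert v (T.image E))) := by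
      rw [disjoint_left]
      intro S hS hS2
      obtain ⟨T, _, rfl⟩ := mem_image.1 hS2
      exact lt_irrefl _ ((mem_allRB.1 hS).2 v (mem_insert_self _ _))
    have hinj : Function.Injective (fun T : Finset ℕ => insert v (T.image E)) := by
      intro T T' h
      simp only at h
      rw [← pull_insert hE (v := v) rfl T, ← pull_insert hE (v := v) rfl T', h]
    rw [hset, card_union_of_disjoint hdisj, card_image_of_injective _ hinj, Fin.sum_univ_succ,
      turanCount_eq, hW'c l (by omega)]
    congr 1
    refine sum_congr rfl fun i _ => ?_
    rw [Fin.val_succ, show l + 1 - ((i : ℕ) + 1) = l - i by omega,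
      show n + 1 - ((i : ℕ) + 1) = n - i by omega]

lemma bel_init {r k m : ℕ} {W : Finset ℕ} (hW : ∀ x ∈ W, x ≤ m) : IsInit r k (bel r k m W) := by
  refine ⟨fun S hS => ((mem_bel hW).1 hS).1, ?_⟩
  intro S T hT hS hlt
  exact (mem_bel hW).2 ⟨hS, hlt.trans ((mem_bel hW).1 hT).2⟩

lemma erase_min_ge {k : ℕ} {W P : Finset ℕ} (hW : W.card ≤ k) (hP : P.card = k + 1)
    (h : wt W ≤ wt P) : ∃ p ∈ P, wt W ≤ wt (P.erase p) := by
  have hne : P.Nonempty := by rw [← card_pos]; omega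
  refine ⟨P.min' hne, P.min'_mem hne, ?_⟩
  set p := P.min' hne with hp
  have hpm : p ∈ P := P.min'_mem hne
  have hmin : ∀ x ∈ P, p ≤ x := fun x hx => P.min'_le x hx
  by_contra hcon
  obtain ⟨a, haW, haP, hag⟩ := wt_lt_iff.1 (not_le.1 hcon)
  have hWP : wt W < wt P := by
    refine lt_of_le_of_ne h fun h' => ?_
    have := wt_inj h'
    rw [this] at hW; omega
  obtain ⟨b, hbP, hbW, hag2⟩ := wt_lt_iff.1 hWP
  by_cases hbp : b = p
  · have hsub : insert a (P.erase p) ⊆ W := by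
      intro x hx
      rw [mem_insert] at hx
      rcases hx with rfl | hx
      · exact haW
      · rw [mem_erase] at hx
        have := hmin x hx.2
        exact (hag2 x (by omega)).2 hx.2
    have := card_le_card hsub
    rw [card_insert_of_notMem haP, card_erase_of_mem hpm] at this
    omega
  · have hbP' : b ∈ P.erase p := mem_erase.2 ⟨hbp, hbP⟩
    rcases lt_trichotomy a b with h1 | h1 | h1
    · exact hbW ((hag b h1).1 hbP')
    · subst h1; exact hbW haW
    · have h2 := (hag2 a h1).1 haW
      have h3 := hmin b hbP
      exact haP (mem_erase.2 ⟨by omega, h2⟩)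

lemma num_bound {r k m : ℕ} (hkr : k < r) {W : Finset ℕ} (hWm : ∀ x ∈ W, x ≤ m)
    {s : ℕ} (hW : RB r (s + 1) W) (hs : s < k) {G : Finset (Finset ℕ)} (hG : ∀ S ∈ G, RB r (k+1) S)
    (hsh : (∂ G).card ≤ (bel r k m W).card) : G.card ≤ (bel r (k+1) m W).card := by
  by_contra hcon
  push Not at hcon
  obtain ⟨I, hI, hIc⟩ := exists_init G hG
  obtain ⟨P, hPI, hPJ⟩ := exists_mem_notMem_of_card_lt_card (hIc ▸ hcon)
  have hP := hI.1 P hPI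
  have hWP : wt W ≤ wt P := by
    by_contra h
    exact hPJ ((mem_bel hWm).2 ⟨hP, not_le.1 h⟩)
  have hQ : bel r k m W ⊆ ∂ I := by
    intro S hS
    obtain ⟨h1, h2⟩ := (mem_bel hWm).1 hS
    obtain ⟨x, hx, hx2⟩ := ext_lemma hkr h1 hW.2 h2 hP hWP
    have hxS : x ∉ S := fun h => hx x h rfl
    refine mem_sh.2 ⟨insert x S, ?_, x, mem_insert_self _ _, erase_insert hxS⟩
    rcases hx2.eq_or_lt with h | h
    · rw [wt_inj h]; exact hPI
    · exact hI.2 _ P hPI (h1.insert hx) h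
  obtain ⟨p, hp, hpW⟩ := erase_min_ge (by rw [hW.1]; omega) hP.1 hWP
  have hpQ : P.erase p ∉ bel r k m W := by
    intro h
    have := ((mem_bel hWm).1 h).2
    omega
  have h1 : insert (P.erase p) (bel r k m W) ⊆ ∂ I :=
    insert_subset (mem_sh.2 ⟨P, hPI, p, hp, rfl⟩) hQ
  have h2 := card_le_card h1
  rw [card_insert_of_notMem hpQ] at h2
  have h3 := kk_all r (by omega) (k+1) G I hG hI hIc
  omega

end FFK

/-- Frankl–Füredi–Kalai bound: if `C` is an `r`-colorable simplicial complex and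
`c_k(C) = T(n_k, k, r) + T(n_{k-1}, k-1, r-1) + ⋯ + T(n_{k-s}, k-s, r-s)` is the
`(k, r)`-canonical representation (encoded by `f : Fin (s+1) → ℕ`, `f i = n_{k-i}`), then
`c_{k+1}(C) ≤ T(n_k, k+1, r) + T(n_{k-1}, k, r-1) + ⋯ + T(n_{k-s}, k-s+1, r-s)`. -/
theorem frankl_furedi_kalai_bound {V : Type*} [DecidableEq V] (C : Finset (Finset V))
    (hempty : ∅ ∈ C) (hsingle : ∀ v : V, {v} ∈ C)
    (hdown : ∀ s ∈ C, ∀ t ⊆ s, t ∈ C)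
    (r : ℕ) (hcol : ∃ g : V → Fin r, ∀ s ∈ C, Set.InjOn g ↑s)
    (k s : ℕ) (f : Fin (s + 1) → ℕ)
    (hkr : k ≤ r)
    (hsk : s < k)
    (hdec : ∀ i : Fin s, f i.succ < f i.castSucc - f i.castSucc / (r - (i : ℕ)))
    (hlast : k - s ≤ f (Fin.last s))
    (hrep : (C.filter fun t => t.card = k).card
        = ∑ i : Fin (s + 1), turanCount (f i) (k - (i : ℕ)) (r - (i : ℕ))) :
    (C.filter fun t => t.card = k + 1).card
      ≤ ∑ i : Fin (s + 1), turanCount (f i) (k - (i : ℕ) + 1) (r - (i : ℕ)) := by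
  obtain ⟨g, hg⟩ := hcol
  have hfin : Finite V := by
    refine Finite.of_injective (fun v => (⟨{v}, hsingle v⟩ : {x // x ∈ C})) ?_
    intro v w h
    simpa using h
  obtain ⟨N, ⟨idx⟩⟩ := Finite.exists_equiv_fin V
  have hmod : ∀ v, ((g v : ℕ) + r * (idx v : ℕ)) % r = g v := by
    intro v
    rw [Nat.add_mul_mod_self_left, Nat.mod_eq_of_lt (g v).2]
  have hr : 0 < r := by omega
  have hinj : Function.Injective (fun v => (g v : ℕ) + r * (idx v : ℕ)) := by
    intro v w h
    simp only at h
    have h1 : (g v : ℕ) = g w := by rw [← hmod v, ← hmod w, h]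
    rw [h1] at h
    have h2 := Nat.eq_of_mul_eq_mul_left hr (Nat.add_left_cancel h)
    exact idx.injective (Fin.ext h2)
  let φ : V ↪ ℕ := ⟨_, hinj⟩
  have hφ : ∀ v, φ v % r = g v := hmod
  have hRB : ∀ l, ∀ S ∈ (C.filter fun t => t.card = l).map (Finset.mapEmbedding φ).toEmbedding,
      FFK.RB r l S := by
    intro l S hS
    obtain ⟨t, ht, rfl⟩ := Finset.mem_map.1 hS
    obtain ⟨htC, htl⟩ := Finset.mem_filter.1 ht
    refine ⟨by simpa using htl, ?_⟩
    intro x hx y hy h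
    obtain ⟨a, ha, rfl⟩ := Finset.mem_map.1 hx
    obtain ⟨b, hb, rfl⟩ := Finset.mem_map.1 hy
    rw [hφ, hφ] at h
    rw [hg t htC ha hb (Fin.ext h)]
  have hG := hRB (k+1)
  set G := (C.filter fun t => t.card = k + 1).map (Finset.mapEmbedding φ).toEmbedding with hGdef
  have hGc : G.card = (C.filter fun t => t.card = k + 1).card := Finset.card_map _
  rw [← hGc]
  rcases hkr.lt_or_eq with hlt | heq
  · obtain ⟨W, hW, hWm, -, hWc⟩ := FFK.cascade s r f (by omega) hdec
    have hsum : ∑ i : Fin (s + 1), turanCount (f i) (k - (i : ℕ) + 1) (r - (i : ℕ)) =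
        (FFK.bel r (k+1) (f 0) W).card := by
      rw [hWc (k+1) (by omega)]
      refine Finset.sum_congr rfl fun i _ => ?_
      have := i.2
      rw [show k - (i : ℕ) + 1 = k + 1 - i by omega]
    rw [hsum]
    refine FFK.num_bound hlt hWm hW hsk hG ?_
    rw [hWc k hsk.le, ← hrep, ← Finset.card_map (Finset.mapEmbedding φ).toEmbedding]
    refine Finset.card_le_card ?_
    intro S hS
    obtain ⟨T, hT, a, ha, rfl⟩ := FFK.mem_sh.1 hS
    obtain ⟨t, ht, rfl⟩ := Finset.mem_map.1 hT
    obtain ⟨htC, htl⟩ := Finset.mem_filter.1 ht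
    obtain ⟨v, hv, rfl⟩ := Finset.mem_map.1 ha
    refine Finset.mem_map.2 ⟨t.erase v, Finset.mem_filter.2
      ⟨hdown t htC _ (Finset.erase_subset _ _), ?_⟩, ?_⟩
    · rw [Finset.card_erase_of_mem hv, htl]; omega
    · exact Finset.map_erase φ t v
  · have : G = ∅ := by
      rw [Finset.eq_empty_iff_forall_notMem]
      intro S hS
      have := (hG S hS).le hr
      omega
    rw [this]; simp
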